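/- There exists a unique skew-dual pairing ⟨,⟩ : B'(so_{2n}) × B(so_{2n}) → ℚ(r,s) of the Hopf algebras B(so_{2n}) and B'(so_{2n}) such that: ⟨f_i, e_j⟩ = δ_{ij}/(s_i − r_i) = δ_{ij}/(s − r); ⟨ω_i', ω_j⟩ = r^{(ε_j,α_i)}s^{(ε_{j+1},α_i)} for i ≤ n and j < n; ⟨ω_i', ω_n⟩ = r^{(ε_{n−1},α_i)}s^{-(ε_n,α_i)} for i ≠ n−1; ⟨ω_{n−1}', ω_n⟩ = r^{(ε_n,α_{n−1})}s^{-(ε_{n−1},α_{n−1})}; ⟨ω_i'^{±1}, ω_j^{-1}⟩ = ⟨ω_i'^{±1}, ω_j⟩^{-1} = ⟨ω_i', ω_j⟩^{∓1}; and all other pairs of generators pair to 0. Moreover this pairing satisfies ⟨S(a), S(b)⟩ = ⟨a, b⟩ for all a ∈ B'(so_{2n}), b ∈ B(so_{2n}). -/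

import Mathlib

/-!
STATEMENT 6.  There exists a unique skew-dual pairing
⟨,⟩ : B'(so_{2n}) × B(so_{2n}) → ℚ(r,s) of the Hopf algebras B(so_{2n})
(generated by the e_j, ω_j^{±1}) and B'(so_{2n}) (generated by the f_j, ω_j'^{±1}),
with the prescribed values on generators, all other pairs of generators pairing to 0;
moreover the pairing satisfies ⟨S(a), S(b)⟩ = ⟨a, b⟩.  (Type Dₙ; the rank is n+2 for
a parameter n : ℕ and all indices are 0-based, the last simple root being
α_{n+1} = ε_n + ε_{n+1}.)
-/

noncomputable section
open scoped TensorProduct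

/-- K = ℚ(r,s) -/
abbrev KK : Type := FractionRing (MvPolynomial (Fin 2) ℚ)
def qr : KK := algebraMap (MvPolynomial (Fin 2) ℚ) KK (MvPolynomial.X 0)
def qs : KK := algebraMap (MvPolynomial (Fin 2) ℚ) KK (MvPolynomial.X 1)

/-- generators e_i, ω_i^{±1} of the positive Hopf subalgebra B -/
inductive GenE (N : ℕ) | e (i : Fin N) | w (i : Fin N) | winv (i : Fin N)

/-- generators f_i, ω_i'^{±1} of the negative Hopf subalgebra B' -/
inductive GenF (N : ℕ) | f (i : Fin N) | wp (i : Fin N) | wpinv (i : Fin N)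

def GenE.toral {N : ℕ} : GenE N → Prop
  | .e _ => False
  | _ => True

def GenF.toral {N : ℕ} : GenF N → Prop
  | .f _ => False
  | _ => True

/-- (ε_j, α_i) for type Dₙ of rank n+2 (0-indexed; α_i = ε_i − ε_{i+1} for i ≤ n,
α_{n+1} = ε_n + ε_{n+1}). -/
def ipaD (n : ℕ) (j i : ℕ) : ℤ :=
  if i < n+1 then (if j = i then 1 else 0) - (if j = i+1 then 1 else 0)
  else (if j = n ∨ j = n+1 then 1 else 0)

/-- (α_i, α_j) -/
def apaD (n : ℕ) (i j : ℕ) : ℤ :=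
  ∑ k ∈ Finset.range (n+2), ipaD n k i * ipaD n k j

/-- the pairing values ⟨ω_i', ω_j⟩ of Proposition 2.3 (4D) -/
def cstD (n : ℕ) (i j : Fin (n+2)) : KK :=
  if (j:ℕ) < n+1 then qr^(ipaD n j i) * qs^(ipaD n ((j:ℕ)+1) i)
  else if (i:ℕ) ≠ n then qr^(ipaD n n i) * qs^(-(ipaD n (n+1) i))
  else qr^(ipaD n (n+1) i) * qs^(-(ipaD n n i))

abbrev FE (n : ℕ) : Type := FreeAlgebra KK (GenE (n+2))
abbrev FF (n : ℕ) : Type := FreeAlgebra KK (GenF (n+2))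
abbrev XE {n : ℕ} : GenE (n+2) → FE n := FreeAlgebra.ι KK
abbrev XF {n : ℕ} : GenF (n+2) → FF n := FreeAlgebra.ι KK

/-- the defining relations of B(so_{2(n+2)}) -/
inductive RelDE (n : ℕ) : FE n → FE n → Prop
  | comm (g g' : GenE (n+2)) (hg : g.toral) (hg' : g'.toral) :
      RelDE n (XE g * XE g') (XE g' * XE g)
  | winv_r (i : Fin (n+2)) : RelDE n (XE (.w i) * XE (.winv i)) 1
  | winv_l (i : Fin (n+2)) : RelDE n (XE (.winv i) * XE (.w i)) 1
  | d2we (i j : Fin (n+2)) (hj : (j:ℕ) < n+1) :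
      RelDE n (XE (.w j) * XE (.e i) * XE (.winv j))
        ((qr^(ipaD n j i) * qs^(ipaD n ((j:ℕ)+1) i)) • XE (.e i))
  | d2wne (k : Fin (n+2)) (hk : (k:ℕ) ≠ n) :
      RelDE n (XE (.w (Fin.last (n+1))) * XE (.e k) * XE (.winv (Fin.last (n+1))))
        ((qr^(ipaD n n k) * qs^(-(ipaD n (n+1) k))) • XE (.e k))
  | d2wnen1 (i : Fin (n+2)) (hi : (i:ℕ) = n) :
      RelDE n (XE (.w (Fin.last (n+1))) * XE (.e i) * XE (.winv (Fin.last (n+1))))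
        ((qr^(ipaD n (n+1) i) * qs^(-(ipaD n n i))) • XE (.e i))
  | d5e (i j : Fin (n+2)) (hne : i ≠ j) (ha : apaD n i j = 0)
      (hp1 : ¬((i:ℕ) = n ∧ (j:ℕ) = n+1)) (hp2 : ¬((i:ℕ) = n+1 ∧ (j:ℕ) = n)) :
      RelDE n (XE (.e i) * XE (.e j) - XE (.e j) * XE (.e i)) 0
  | d5en (i j : Fin (n+2)) (hi : (i:ℕ) = n) (hj : (j:ℕ) = n+1) :
      RelDE n (XE (.e i) * XE (.e j)) ((qr*qs) • (XE (.e j) * XE (.e i)))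
  | d6a (i j : Fin (n+2)) (hij : i < j) (ha : apaD n i j = -1) :
      RelDE n (XE (.e i)^2 * XE (.e j) - (qr + qs) • (XE (.e i) * XE (.e j) * XE (.e i))
        + (qr*qs) • (XE (.e j) * XE (.e i)^2)) 0
  | d6b (i j : Fin (n+2)) (hij : i < j) (ha : apaD n i j = -1) :
      RelDE n (XE (.e j)^2 * XE (.e i) - (qr⁻¹ + qs⁻¹) • (XE (.e j) * XE (.e i) * XE (.e j))
        + (qr*qs)⁻¹ • (XE (.e i) * XE (.e j)^2)) 0

/-- the defining relations of B'(so_{2(n+2)}) -/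
inductive RelDF (n : ℕ) : FF n → FF n → Prop
  | comm (g g' : GenF (n+2)) (hg : g.toral) (hg' : g'.toral) :
      RelDF n (XF g * XF g') (XF g' * XF g)
  | wpinv_r (i : Fin (n+2)) : RelDF n (XF (.wp i) * XF (.wpinv i)) 1
  | wpinv_l (i : Fin (n+2)) : RelDF n (XF (.wpinv i) * XF (.wp i)) 1
  | d3wpf (i j : Fin (n+2)) (hj : (j:ℕ) < n+1) :
      RelDF n (XF (.wp j) * XF (.f i) * XF (.wpinv j))
        ((qs^(-(ipaD n j i)) * qr^(-(ipaD n ((j:ℕ)+1) i))) • XF (.f i))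
  | d3wpnf (k : Fin (n+2)) (hk : (k:ℕ) ≠ n) :
      RelDF n (XF (.wp (Fin.last (n+1))) * XF (.f k) * XF (.wpinv (Fin.last (n+1))))
        ((qs^(-(ipaD n n k)) * qr^(ipaD n (n+1) k)) • XF (.f k))
  | d3wpnfn1 (i : Fin (n+2)) (hi : (i:ℕ) = n) :
      RelDF n (XF (.wp (Fin.last (n+1))) * XF (.f i) * XF (.wpinv (Fin.last (n+1))))
        ((qs^(-(ipaD n (n+1) i)) * qr^(ipaD n n i)) • XF (.f i))
  | d5f (i j : Fin (n+2)) (hne : i ≠ j) (ha : apaD n i j = 0)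
      (hp1 : ¬((i:ℕ) = n ∧ (j:ℕ) = n+1)) (hp2 : ¬((i:ℕ) = n+1 ∧ (j:ℕ) = n)) :
      RelDF n (XF (.f i) * XF (.f j) - XF (.f j) * XF (.f i)) 0
  | d5fn (i j : Fin (n+2)) (hi : (i:ℕ) = n) (hj : (j:ℕ) = n+1) :
      RelDF n (XF (.f j) * XF (.f i)) ((qr*qs) • (XF (.f i) * XF (.f j)))
  | d7a (i j : Fin (n+2)) (hij : i < j) (ha : apaD n i j = -1) :
      RelDF n (XF (.f j) * XF (.f i)^2 - (qr + qs) • (XF (.f i) * XF (.f j) * XF (.f i))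
        + (qr*qs) • (XF (.f i)^2 * XF (.f j))) 0
  | d7b (i j : Fin (n+2)) (hij : i < j) (ha : apaD n i j = -1) :
      RelDF n (XF (.f i) * XF (.f j)^2 - (qr⁻¹ + qs⁻¹) • (XF (.f j) * XF (.f i) * XF (.f j))
        + (qr*qs)⁻¹ • (XF (.f j)^2 * XF (.f i))) 0

/-- the Hopf subalgebra B (upper part) -/
abbrev BA (n : ℕ) : Type := RingQuot (RelDE n)
/-- the Hopf subalgebra B' (lower part) -/
abbrev BA' (n : ℕ) : Type := RingQuot (RelDF n)

def genBE (n : ℕ) (g : GenE (n+2)) : BA n := RingQuot.mkAlgHom KK (RelDE n) (XE g)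
def genBF (n : ℕ) (g : GenF (n+2)) : BA' n := RingQuot.mkAlgHom KK (RelDF n) (XF g)

/-- the conditions defining the skew-dual pairing ⟨,⟩ : B' × B → K of Proposition 2.3:
it is a dual pairing of B'^{cop} and B, with the prescribed values on generators
(all other pairs of generators pairing to 0). -/
def PairCond (n : ℕ) (ΔB : BA n →ₐ[KK] (BA n ⊗[KK] BA n)) (εB : BA n →ₐ[KK] KK)
    (ΔB' : BA' n →ₐ[KK] (BA' n ⊗[KK] BA' n)) (εB' : BA' n →ₐ[KK] KK)
    (p : BA' n →ₗ[KK] BA n →ₗ[KK] KK) : Prop :=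
  (∀ f, p f 1 = εB' f) ∧ (∀ a, p 1 a = εB a) ∧
  (∀ f a a', p f (a * a')
    = LinearMap.mul' KK KK ((TensorProduct.map (p.flip a') (p.flip a)) (ΔB'.toLinearMap f))) ∧
  (∀ f f' a, p (f * f') a
    = LinearMap.mul' KK KK ((TensorProduct.map (p f) (p f')) (ΔB.toLinearMap a))) ∧
  (∀ i j, p (genBF n (.f i)) (genBE n (.e j))
    = if i = j then (qs - qr)⁻¹ else 0) ∧
  (∀ i j, p (genBF n (.wp i)) (genBE n (.w j)) = cstD n i j) ∧
  (∀ i j, p (genBF n (.wp i)) (genBE n (.winv j)) = (cstD n i j)⁻¹) ∧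
  (∀ i j, p (genBF n (.wpinv i)) (genBE n (.w j)) = (cstD n i j)⁻¹) ∧
  (∀ i j, p (genBF n (.wpinv i)) (genBE n (.winv j)) = cstD n i j) ∧
  (∀ i j, p (genBF n (.f i)) (genBE n (.w j)) = 0) ∧
  (∀ i j, p (genBF n (.f i)) (genBE n (.winv j)) = 0) ∧
  (∀ i j, p (genBF n (.wp i)) (genBE n (.e j)) = 0) ∧
  (∀ i j, p (genBF n (.wpinv i)) (genBE n (.e j)) = 0)

section QSerre

variable {K A : Type*} [Field K] [Ring A] [Algebra K A]

/-- The quantum Serre polynomial `x²y - (r+s)xyx + rs yx²`. -/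
def qSerre (r s : K) (x y : A) : A :=
  x * x * y - (r + s) • (x * y * x) + (r * s) • (y * x * x)

/-- The `q`-commutator `xy - q yx`. -/
def qComm (q : K) (x y : A) : A := x * y - q • (y * x)

theorem qSerre_swap (r s : K) (x y : A) : qSerre r s x y = qSerre s r x y := by
  simp only [qSerre, add_comm r s, mul_comm r s]

theorem qSerre_add {r s : K} (hr : r ≠ 0) (hs : s ≠ 0) {a₁ a₂ b₁ b₂ : A}
    (h₁₁ : b₁ * a₁ = (r / s) • (a₁ * b₁)) (h₁₂ : b₁ * a₂ = s • (a₂ * b₁))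
    (h₂₁ : b₂ * a₁ = r⁻¹ • (a₁ * b₂)) :
    qSerre r s (a₁ + b₁) (a₂ + b₂) = qSerre r s a₁ a₂ + qSerre r s b₁ b₂ := by
  have k₁₁ (z : A) : b₁ * (a₁ * z) = (r / s) • (a₁ * (b₁ * z)) := by
    rw [← mul_assoc, h₁₁, smul_mul_assoc, mul_assoc]
  have k₁₂ (z : A) : b₁ * (a₂ * z) = s • (a₂ * (b₁ * z)) := by
    rw [← mul_assoc, h₁₂, smul_mul_assoc, mul_assoc]
  have k₂₁ (z : A) : b₂ * (a₁ * z) = r⁻¹ • (a₁ * (b₂ * z)) := by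
    rw [← mul_assoc, h₂₁, smul_mul_assoc, mul_assoc]
  simp only [qSerre, mul_add, add_mul, mul_assoc, h₁₁, h₁₂, h₂₁, k₁₁, k₁₂, k₂₁, mul_smul_comm,
    smul_mul_assoc]
  match_scalars <;> field_simp <;> ring

theorem qSerre_add' {r s : K} (hr : r ≠ 0) (hs : s ≠ 0) {a₁ a₂ b₁ b₂ : A}
    (h₂₂ : b₂ * a₂ = (r / s) • (a₂ * b₂)) (h₁₂ : b₁ * a₂ = s • (a₂ * b₁))
    (h₂₁ : b₂ * a₁ = r⁻¹ • (a₁ * b₂)) :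
    qSerre r⁻¹ s⁻¹ (a₂ + b₂) (a₁ + b₁) = qSerre r⁻¹ s⁻¹ a₂ a₁ + qSerre r⁻¹ s⁻¹ b₂ b₁ := by
  simp only [qSerre_swap r⁻¹ s⁻¹]
  apply qSerre_add (inv_ne_zero hs) (inv_ne_zero hr) _ h₂₁
  · rwa [inv_inv]
  · rw [h₂₂]; congr 1; field_simp

theorem qComm_add {q : K} (hq : q ≠ 0) {a₁ a₂ b₁ b₂ : A}
    (h₁₂ : b₁ * a₂ = q • (a₂ * b₁)) (h₂₁ : b₂ * a₁ = q⁻¹ • (a₁ * b₂)) :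
    qComm q (a₁ + b₁) (a₂ + b₂) = qComm q a₁ a₂ + qComm q b₁ b₂ := by
  simp only [qComm, mul_add, add_mul, h₁₂, h₂₁]
  match_scalars <;> field_simp <;> ring

theorem qSerre_smul (r s : K) (k l : K) (x y : A) :
    qSerre r s (k • x) (l • y) = (k * k * l) • qSerre r s x y := by
  simp only [qSerre, smul_mul_assoc, mul_smul_comm]
  module

open MulOpposite in
theorem qSerre_op {r s : K} (hr : r ≠ 0) (hs : s ≠ 0) {u v x y : A} (huv : v * u = u * v)
    (hxu : x * u = (r / s) • (u * x)) (hxv : x * v = r⁻¹ • (v * x)) (hyu : y * u = s • (u * y)) :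
    qSerre r s (op (u * x)) (op (v * y)) = op (u * u * v * qSerre r s x y) := by
  have kuv (z : A) : v * (u * z) = u * (v * z) := by
    rw [← mul_assoc, huv, mul_assoc]
  have kxu (z : A) : x * (u * z) = (r / s) • (u * (x * z)) := by
    rw [← mul_assoc, hxu, smul_mul_assoc, mul_assoc]
  have kxv (z : A) : x * (v * z) = r⁻¹ • (v * (x * z)) := by
    rw [← mul_assoc, hxv, smul_mul_assoc, mul_assoc]
  have kyu (z : A) : y * (u * z) = s • (u * (y * z)) := by
    rw [← mul_assoc, hyu, smul_mul_assoc, mul_assoc]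
  simp only [qSerre, ← op_mul, ← op_smul, ← op_sub, ← op_add, mul_add, mul_sub, mul_assoc,
    mul_smul_comm, kuv, kxu, kxv, kyu]
  congr 1
  match_scalars <;> field_simp

theorem map_qSerre {B : Type*} [Ring B] [Algebra K B] (φ : A →ₐ[K] B) (r s : K) (x y : A) :
    φ (qSerre r s x y) = qSerre r s (φ x) (φ y) := by
  simp [qSerre]

theorem map_qComm {B : Type*} [Ring B] [Algebra K B] (φ : A →ₐ[K] B) (q : K) (x y : A) :
    φ (qComm q x y) = qComm q (φ x) (φ y) := by
  simp [qComm]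

theorem qSerre_tmul {B : Type*} [Ring B] [Algebra K B] (r s : K) {u v : A} (h : u * v = v * u)
    (x y : B) :
    qSerre r s (u ⊗ₜ[K] x) (v ⊗ₜ[K] y) = (u * u * v) ⊗ₜ[K] qSerre r s x y := by
  have h₁ : u * v * u = u * u * v := by rw [mul_assoc, ← h, mul_assoc]
  have h₂ : v * u * u = u * u * v := by rw [← h, h₁]
  simp only [qSerre, Algebra.TensorProduct.tmul_mul_tmul, h₁, h₂, TensorProduct.tmul_add,
    TensorProduct.tmul_sub, TensorProduct.tmul_smul]

theorem qSerre_tmul_one {B : Type*} [Ring B] [Algebra K B] (r s : K) (x y : A) :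
    qSerre r s (x ⊗ₜ[K] (1 : B)) (y ⊗ₜ[K] 1) = qSerre r s x y ⊗ₜ[K] 1 :=
  (map_qSerre (Algebra.TensorProduct.includeLeft : A →ₐ[K] A ⊗[K] B) r s x y).symm

theorem qComm_tmul {B : Type*} [Ring B] [Algebra K B] (q : K) {u v : A} (h : u * v = v * u)
    (x y : B) :
    qComm q (u ⊗ₜ[K] x) (v ⊗ₜ[K] y) = (u * v) ⊗ₜ[K] qComm q x y := by
  simp only [qComm, Algebra.TensorProduct.tmul_mul_tmul, h, TensorProduct.tmul_sub,
    TensorProduct.tmul_smul]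

theorem qComm_tmul_one {B : Type*} [Ring B] [Algebra K B] (q : K) (x y : A) :
    qComm q (x ⊗ₜ[K] (1 : B)) (y ⊗ₜ[K] 1) = qComm q x y ⊗ₜ[K] 1 :=
  (map_qComm (Algebra.TensorProduct.includeLeft : A →ₐ[K] A ⊗[K] B) q x y).symm

end QSerre

/-- Combinatorial data of a two-parameter quantum Borel algebra: the parameters, the
multiplicative form `c`, and the pairs of orthogonal and of adjacent simple roots. -/
structure SkewDatum (ι K : Type*) [Field K] where
  r : K
  s : K
  c : ι → ι → K
  orth : ι → ι → Prop
  adj : ι → ι → Prop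
  r_ne : r ≠ 0
  s_ne : s ≠ 0
  c_ne : ∀ i j, c i j ≠ 0
  c_self : ∀ i, c i i = r / s
  c_orth : ∀ {i j}, orth i j → c i j = (c j i)⁻¹
  c_adj : ∀ {i j}, adj i j → c i j = r⁻¹
  c_adj' : ∀ {i j}, adj i j → c j i = s

namespace SkewDatum

section Rep

variable {ι K : Type*} [Field K]

/-- The datum with transposed form, governing the opposite Borel algebra. -/
def dual (D : SkewDatum ι K) : SkewDatum ι K where
  r := D.s⁻¹
  s := D.r⁻¹
  c i j := D.c j i
  orth := D.orth
  adj := D.adj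
  r_ne := inv_ne_zero D.s_ne
  s_ne := inv_ne_zero D.r_ne
  c_ne i j := D.c_ne j i
  c_self i := by
    have := D.r_ne
    have := D.s_ne
    rw [D.c_self]
    field_simp
  c_orth h := by rw [D.c_orth h, inv_inv]
  c_adj h := by rw [D.c_adj' h, inv_inv]
  c_adj' h := D.c_adj h

@[simp] theorem dual_c (D : SkewDatum ι K) (i j : ι) : D.dual.c i j = D.c j i := rfl

/-- The defining relations of the quantum Borel algebra attached to `D`. -/
structure IsRep (D : SkewDatum ι K) {A : Type*} [Ring A] [Algebra K A] (E W V : ι → A) :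
    Prop where
  mul_inv : ∀ i, W i * V i = 1
  inv_mul : ∀ i, V i * W i = 1
  comm : ∀ i j, W i * W j = W j * W i
  conj : ∀ i j, W j * E i = D.c i j • (E i * W j)
  orth : ∀ {i j}, D.orth i j → qComm (D.c j i) (E i) (E j) = 0
  adj : ∀ {i j}, D.adj i j → qSerre D.r D.s (E i) (E j) = 0
  adj' : ∀ {i j}, D.adj i j → qSerre D.r⁻¹ D.s⁻¹ (E j) (E i) = 0

namespace IsRep

variable {D : SkewDatum ι K} {A : Type*} [Ring A] [Algebra K A] {E W V : ι → A}

theorem commute (h : D.IsRep E W V) (i j : ι) : Commute (W i) (W j) := h.comm i j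

theorem commute_inv (h : D.IsRep E W V) (i j : ι) : Commute (W i) (V j) := by
  let u : Aˣ := ⟨W j, V j, h.mul_inv j, h.inv_mul j⟩
  exact Commute.units_inv_right (u := u) (h.commute i j)

theorem inv_commute_inv (h : D.IsRep E W V) (i j : ι) : Commute (V i) (V j) := by
  let u : Aˣ := ⟨W i, V i, h.mul_inv i, h.inv_mul i⟩
  exact Commute.units_inv_left (u := u) (h.commute_inv i j)

theorem conj_inv (h : D.IsRep E W V) (i j : ι) : E i * V j = D.c i j • (V j * E i) := by
  calc E i * V j = V j * (W j * E i) * V j := by rw [← mul_assoc, h.inv_mul, one_mul]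
    _ = D.c i j • (V j * E i) := by
      rw [h.conj, mul_smul_comm, smul_mul_assoc, mul_assoc, mul_assoc, h.mul_inv, mul_one]

/-- Two representations with the same torus whose root vectors `q`-commute can be added. -/
theorem add {E' : ι → A} (h : D.IsRep E W V) (h' : D.IsRep E' W V)
    (H : ∀ i j, E' j * E i = D.c i j • (E i * E' j)) :
    D.IsRep (fun i => E i + E' i) W V where
  mul_inv := h.mul_inv
  inv_mul := h.inv_mul
  comm := h.comm
  conj i j := by rw [mul_add, add_mul, smul_add, h.conj, h'.conj]
  orth {i j} hij := by
    rw [qComm_add (D.c_ne j i) (H j i) (by rw [H, D.c_orth hij]), h.orth hij, h'.orth hij,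
      add_zero]
  adj {i j} hij := by
    rw [qSerre_add D.r_ne D.s_ne (by rw [H, D.c_self]) (by rw [H, D.c_adj' hij])
      (by rw [H, D.c_adj hij]), h.adj hij, h'.adj hij, add_zero]
  adj' {i j} hij := by
    rw [qSerre_add' D.r_ne D.s_ne (by rw [H, D.c_self]) (by rw [H, D.c_adj' hij])
      (by rw [H, D.c_adj hij]), h.adj' hij, h'.adj' hij, add_zero]

/-- Root vectors may be rescaled. -/
theorem smul (h : D.IsRep E W V) (t : ι → K) : D.IsRep (fun i => t i • E i) W V where
  mul_inv := h.mul_inv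
  inv_mul := h.inv_mul
  comm := h.comm
  conj i j := by simp only [mul_smul_comm, smul_mul_assoc, h.conj, smul_comm (t i)]
  orth {i j} hij := by
    have := h.orth hij
    simp only [qComm, smul_mul_assoc, mul_smul_comm] at this ⊢
    rw [sub_eq_zero] at this ⊢
    rw [this]
    module
  adj hij := by rw [qSerre_smul, h.adj hij, smul_zero]
  adj' hij := by rw [qSerre_smul, h.adj' hij, smul_zero]

/-- The torus may be rescaled. -/
theorem smul_torus (h : D.IsRep E W V) {t : ι → K} (ht : ∀ i, t i ≠ 0) :
    D.IsRep E (fun i => t i • W i) (fun i => (t i)⁻¹ • V i) where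
  mul_inv i := by simp [smul_smul, h.mul_inv, ht i]
  inv_mul i := by simp [smul_smul, h.inv_mul, ht i]
  comm i j := by simp only [smul_mul_smul_comm, h.comm i j, mul_comm (t i)]
  conj i j := by simp only [mul_smul_comm, smul_mul_assoc, h.conj, smul_comm (t j)]
  orth := h.orth
  adj := h.adj
  adj' := h.adj'

theorem counit (D : SkewDatum ι K) : D.IsRep (fun _ => (0 : K)) (fun _ => 1) (fun _ => 1) := by
  constructor <;> simp [qComm, qSerre]

theorem tmul_one (h : D.IsRep E W V) : D.IsRep (fun i => E i ⊗ₜ[K] (1 : A))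
    (fun i => W i ⊗ₜ[K] W i) (fun i => V i ⊗ₜ[K] V i) where
  mul_inv i := by simp [h.mul_inv, Algebra.TensorProduct.one_def]
  inv_mul i := by simp [h.inv_mul, Algebra.TensorProduct.one_def]
  comm i j := by simp [h.comm i j]
  conj i j := by simp [h.conj, TensorProduct.smul_tmul']
  orth hij := by rw [qComm_tmul_one, h.orth hij, TensorProduct.zero_tmul]
  adj hij := by rw [qSerre_tmul_one, h.adj hij, TensorProduct.zero_tmul]
  adj' hij := by rw [qSerre_tmul_one, h.adj' hij, TensorProduct.zero_tmul]

theorem tmul_self (h : D.IsRep E W V) : D.IsRep (fun i => W i ⊗ₜ[K] E i)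
    (fun i => W i ⊗ₜ[K] W i) (fun i => V i ⊗ₜ[K] V i) where
  mul_inv i := by simp [h.mul_inv, Algebra.TensorProduct.one_def]
  inv_mul i := by simp [h.inv_mul, Algebra.TensorProduct.one_def]
  comm i j := by simp [h.comm i j]
  conj i j := by simp [h.conj, h.comm j i]
  orth hij := by rw [qComm_tmul _ (h.comm _ _), h.orth hij, TensorProduct.tmul_zero]
  adj hij := by rw [qSerre_tmul _ _ (h.comm _ _), h.adj hij, TensorProduct.tmul_zero]
  adj' hij := by rw [qSerre_tmul _ _ (h.comm _ _), h.adj' hij, TensorProduct.tmul_zero]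

theorem comul (h : D.IsRep E W V) :
    D.IsRep (fun i => E i ⊗ₜ[K] (1 : A) + W i ⊗ₜ[K] E i)
      (fun i => W i ⊗ₜ[K] W i) (fun i => V i ⊗ₜ[K] V i) :=
  h.tmul_one.add h.tmul_self fun i j => by simp [h.conj, TensorProduct.smul_tmul']

open MulOpposite in
theorem antipode (h : D.IsRep E W V) :
    D.IsRep (fun i => op (V i * E i)) (fun i => op (V i)) (fun i => op (W i)) where
  mul_inv i := by rw [← op_mul, h.mul_inv, op_one]
  inv_mul i := by rw [← op_mul, h.inv_mul, op_one]
  comm i j := by rw [← op_mul, (h.inv_commute_inv j i).eq, op_mul]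
  conj i j := by
    rw [← op_mul, ← op_mul, ← op_smul, mul_assoc, h.conj_inv, mul_smul_comm, ← mul_assoc,
      (h.inv_commute_inv i j).eq, mul_assoc]
  orth {i j} hij := by
    have key : D.c i j * D.c j i = 1 := by rw [D.c_orth hij, inv_mul_cancel₀ (D.c_ne j i)]
    have h₁ : V j * E j * (V i * E i) = D.c j i • (V j * V i * (E j * E i)) := by
      rw [mul_assoc, ← mul_assoc (E j), h.conj_inv, smul_mul_assoc, mul_smul_comm]
      simp only [mul_assoc]
    have h₂ : V i * E i * (V j * E j) = V j * V i * (E j * E i) := by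
      rw [mul_assoc, ← mul_assoc (E i), h.conj_inv, smul_mul_assoc, mul_smul_comm, mul_assoc,
        sub_eq_zero.mp (h.orth hij), mul_smul_comm, mul_smul_comm, smul_smul, key, one_smul,
        ← mul_assoc, (h.inv_commute_inv i j).eq]
    rw [qComm, ← op_mul, ← op_mul, ← op_smul, h₁, h₂, sub_self]
  adj {i j} hij := by
    rw [qSerre_op D.r_ne D.s_ne (h.inv_commute_inv j i).eq (by rw [h.conj_inv, D.c_self])
      (by rw [h.conj_inv, D.c_adj hij]) (by rw [h.conj_inv, D.c_adj' hij]), h.adj hij, mul_zero,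
      op_zero]
  adj' {i j} hij := by
    rw [qSerre_swap, qSerre_op (inv_ne_zero D.s_ne) (inv_ne_zero D.r_ne)
      (h.inv_commute_inv i j).eq (by rw [h.conj_inv, D.c_self, inv_div_inv])
      (by rw [h.conj_inv, D.c_adj' hij, inv_inv]) (by rw [h.conj_inv, D.c_adj hij]), qSerre_swap,
      h.adj' hij, mul_zero, op_zero]

/-- Upper triangular representation encoding the skew derivation dual to the `j`-th root vector. -/
theorem matrix [DecidableEq ι] (h : D.IsRep E W V) (j : ι) (κ : K) :
    D.IsRep (fun i => !![E i, if i = j then κ • W i else 0; 0, E i])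
      (fun i => !![D.c j i • W i, 0; 0, W i]) (fun i => !![(D.c j i)⁻¹ • V i, 0; 0, V i]) := by
  have t := h.smul_torus (D.c_ne j)
  have e₀ : (!![0, 0; 0, 0] : Matrix (Fin 2) (Fin 2) A) = 0 := by
    ext a b; fin_cases a <;> fin_cases b <;> rfl
  have sm (k : K) (a b c d : A) : k • !![a, b; c, d] = !![k • a, k • b; k • c, k • d] := by
    ext a b; fin_cases a <;> fin_cases b <;> rfl
  have sb (a b c d a' b' c' d' : A) :
      !![a, b; c, d] - !![a', b'; c', d'] = !![a - a', b - b'; c - c', d - d'] := by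
    ext a b; fin_cases a <;> fin_cases b <;> rfl
  have ad (a b c d a' b' c' d' : A) :
      !![a, b; c, d] + !![a', b'; c', d'] = !![a + a', b + b'; c + c', d + d'] := by
    ext a b; fin_cases a <;> fin_cases b <;> rfl
  have h₁ : D.IsRep (fun i => !![E i, 0; 0, E i])
      (fun i => !![D.c j i • W i, 0; 0, W i]) (fun i => !![(D.c j i)⁻¹ • V i, 0; 0, V i]) := by
    constructor
    · intro i
      simp only [Matrix.mul_fin_two, Matrix.one_fin_two, t.mul_inv, h.mul_inv, mul_zero, zero_mul,
        add_zero, zero_add]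
    · intro i
      simp only [Matrix.mul_fin_two, Matrix.one_fin_two, t.inv_mul, h.inv_mul, mul_zero, zero_mul,
        add_zero, zero_add]
    · intro i k
      simp only [Matrix.mul_fin_two, t.comm i k, h.comm i k, mul_zero, zero_mul, add_zero, zero_add]
    · intro i k
      simp only [Matrix.mul_fin_two, t.conj i k, h.conj i k, mul_zero, zero_mul, add_zero, zero_add,
        sm, smul_zero]
    · intro i k hik
      have := h.orth hik
      rw [qComm] at this
      simp only [qComm, Matrix.mul_fin_two, sm, sb, mul_zero, zero_mul, add_zero, zero_add,
        smul_zero, sub_zero, this, e₀]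
    · intro i k hik
      have := h.adj hik
      rw [qSerre] at this
      simp only [qSerre, Matrix.mul_fin_two, sm, sb, ad, mul_zero, zero_mul, add_zero, zero_add,
        smul_zero, sub_zero, this, e₀]
    · intro i k hik
      have := h.adj' hik
      rw [qSerre] at this
      simp only [qSerre, Matrix.mul_fin_two, sm, sb, ad, mul_zero, zero_mul, add_zero, zero_add,
        smul_zero, sub_zero, this, e₀]
  have sq (a b : A) : !![0, a; 0, 0] * !![0, b; 0, 0] = 0 := by
    simp only [Matrix.mul_fin_two, mul_zero, zero_mul, add_zero, e₀]
  have h₂ : D.IsRep (fun i => !![0, if i = j then κ • W i else 0; 0, 0])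
      (fun i => !![D.c j i • W i, 0; 0, W i]) (fun i => !![(D.c j i)⁻¹ • V i, 0; 0, V i]) := by
    refine ⟨h₁.mul_inv, h₁.inv_mul, h₁.comm, fun i k => ?_, fun hik => ?_, fun hik => ?_,
      fun hik => ?_⟩
    · by_cases hi : i = j
      · subst hi
        simp only [Matrix.mul_fin_two, sm, if_true, mul_zero, zero_mul, add_zero, zero_add,
          smul_zero, smul_mul_assoc, mul_smul_comm, h.comm i k, smul_comm κ]
      · simp only [hi, Matrix.mul_fin_two, sm, if_false, mul_zero, zero_mul, add_zero, smul_zero]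
    · simp only [qComm, sq, smul_zero, sub_zero]
    · simp only [qSerre, sq, zero_mul, smul_zero, sub_zero, add_zero]
    · simp only [qSerre, sq, zero_mul, smul_zero, sub_zero, add_zero]
  have := h₁.add h₂ fun i k => by
    by_cases hk : k = j
    · simp only [hk, Matrix.mul_fin_two, sm, if_true, mul_zero, zero_mul, add_zero, zero_add,
        smul_zero, smul_mul_assoc, mul_smul_comm, h.conj, smul_comm κ]
    · simp only [hk, Matrix.mul_fin_two, sm, if_false, mul_zero, zero_mul, add_zero, smul_zero]
  simpa only [ad, add_zero, zero_add] using this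

end IsRep
end Rep

section Universal

universe u

variable {ι K : Type u} [Field K]

/-- `H` is generated by a universal representation of the relations of `D`. -/
structure IsUniversal (D : SkewDatum ι K) {H : Type u} [Ring H] [Algebra K H] (E W V : ι → H) :
    Prop where
  rep : D.IsRep E W V
  lift : ∀ {A : Type u} [Ring A] [Algebra K A] {E' W' V' : ι → A}, D.IsRep E' W' V' →
    ∃ φ : H →ₐ[K] A, ∀ i, φ (E i) = E' i ∧ φ (W i) = W' i ∧ φ (V i) = V' i
  induction : ∀ {P : H → Prop}, (∀ k, P (algebraMap K H k)) → (∀ i, P (E i)) → (∀ i, P (W i)) →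
    (∀ i, P (V i)) → (∀ x y, P x → P y → P (x + y)) → (∀ x y, P x → P y → P (x * y)) → ∀ x, P x

namespace IsUniversal

variable {D : SkewDatum ι K} {H : Type u} [Ring H] [Algebra K H] {E W V : ι → H}

theorem hom_ext {A : Type*} [Ring A] [Algebra K A] (h : D.IsUniversal E W V) {φ ψ : H →ₐ[K] A}
    (hE : ∀ i, φ (E i) = ψ (E i)) (hW : ∀ i, φ (W i) = ψ (W i)) (hV : ∀ i, φ (V i) = ψ (V i)) :
    φ = ψ := by
  ext x
  exact h.induction (P := fun x => φ x = ψ x) (by simp) hE hW hV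
    (fun x y hx hy => by rw [map_add, map_add, hx, hy])
    (fun x y hx hy => by rw [map_mul, map_mul, hx, hy]) x

theorem exists_comul (h : D.IsUniversal E W V) : ∃ Δ : H →ₐ[K] H ⊗[K] H, ∀ i,
    Δ (W i) = W i ⊗ₜ W i ∧ Δ (V i) = V i ⊗ₜ V i ∧ Δ (E i) = E i ⊗ₜ 1 + W i ⊗ₜ E i := by
  obtain ⟨Δ, hΔ⟩ := h.lift h.rep.comul
  exact ⟨Δ, fun i => ⟨(hΔ i).2.1, (hΔ i).2.2, (hΔ i).1⟩⟩

theorem exists_comul_swap (h : D.IsUniversal E W V) : ∃ Δ : H →ₐ[K] H ⊗[K] H, ∀ i,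
    Δ (W i) = W i ⊗ₜ W i ∧ Δ (V i) = V i ⊗ₜ V i ∧ Δ (E i) = 1 ⊗ₜ E i + E i ⊗ₜ W i := by
  obtain ⟨Δ, hΔ⟩ := h.exists_comul
  exact ⟨(Algebra.TensorProduct.comm K H H : H ⊗[K] H →ₐ[K] H ⊗[K] H).comp Δ,
    fun i => by simp [hΔ i]⟩

theorem exists_counit (h : D.IsUniversal E W V) : ∃ ε : H →ₐ[K] K, ∀ i,
    ε (W i) = 1 ∧ ε (V i) = 1 ∧ ε (E i) = 0 := by
  obtain ⟨ε, hε⟩ := h.lift (IsRep.counit D)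
  exact ⟨ε, fun i => ⟨(hε i).2.1, (hε i).2.2, (hε i).1⟩⟩

theorem exists_antihom (h : D.IsUniversal E W V) (t : ι → K) : ∃ S : H →ₗ[K] H,
    S 1 = 1 ∧ (∀ x y, S (x * y) = S y * S x) ∧
    ∀ i, S (W i) = V i ∧ S (V i) = W i ∧ S (E i) = t i • (V i * E i) := by
  obtain ⟨φ, hφ⟩ := h.lift (h.rep.antipode.smul t)
  refine ⟨(MulOpposite.opLinearEquiv K).symm.toLinearMap ∘ₗ φ.toLinearMap, by simp, by simp,
    fun i => ?_⟩
  simp [hφ i]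

theorem exists_antipode (h : D.IsUniversal E W V) : ∃ S : H →ₗ[K] H,
    S 1 = 1 ∧ (∀ x y, S (x * y) = S y * S x) ∧
    ∀ i, S (W i) = V i ∧ S (V i) = W i ∧ S (E i) = -(V i * E i) := by
  obtain ⟨S, h₁, h₂, h₃⟩ := h.exists_antihom fun _ => -1
  exact ⟨S, h₁, h₂, fun i => by simp [h₃ i]⟩

theorem exists_antipode_swap (h : D.IsUniversal E W V) : ∃ S : H →ₗ[K] H,
    S 1 = 1 ∧ (∀ x y, S (x * y) = S y * S x) ∧
    ∀ i, S (W i) = V i ∧ S (V i) = W i ∧ S (E i) = -(E i * V i) := by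
  obtain ⟨S, h₁, h₂, h₃⟩ := h.exists_antihom fun i => -D.c i i
  exact ⟨S, h₁, h₂, fun i => by simp [h₃ i, h.rep.conj_inv i i]⟩

theorem exists_twist (h : D.IsUniversal E W V) {t : ι → K} (ht : ∀ i, t i ≠ 0) :
    ∃ φ : H →ₐ[K] H, ∀ i, φ (E i) = E i ∧ φ (W i) = t i • W i ∧ φ (V i) = (t i)⁻¹ • V i :=
  h.lift (h.rep.smul_torus ht)

theorem exists_skewDerivation (h : D.IsUniversal E W V) (j : ι) (κ : K) {φ : H →ₐ[K] H}
    (hφ : ∀ i, φ (E i) = E i ∧ φ (W i) = D.c j i • W i ∧ φ (V i) = (D.c j i)⁻¹ • V i) :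
    ∃ δ : H →ₗ[K] H, (∀ x y, δ (x * y) = δ x * y + φ x * δ y) ∧
      (∀ i, i ≠ j → δ (E i) = 0) ∧ δ (E j) = κ • W j ∧ (∀ i, δ (W i) = 0) ∧ ∀ i, δ (V i) = 0 := by
  classical
  obtain ⟨ψ, hψ⟩ := h.lift (h.rep.matrix j κ)
  have key : ∀ x, ψ x 0 0 = φ x ∧ ψ x 1 0 = 0 ∧ ψ x 1 1 = x := by
    refine h.induction (P := fun x => ψ x 0 0 = φ x ∧ ψ x 1 0 = 0 ∧ ψ x 1 1 = x) ?_ ?_ ?_ ?_ ?_ ?_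
    · intro k; simp [Algebra.algebraMap_eq_smul_one]
    · intro i; simp [hψ i, hφ i]
    · intro i; simp [hψ i, hφ i]
    · intro i; simp [hψ i, hφ i]
    · rintro x y ⟨hx₁, hx₂, hx₃⟩ ⟨hy₁, hy₂, hy₃⟩
      simp [hx₁, hx₂, hx₃, hy₁, hy₂, hy₃]
    · rintro x y ⟨hx₁, hx₂, hx₃⟩ ⟨hy₁, hy₂, hy₃⟩
      simp [Matrix.mul_apply, hx₁, hx₂, hx₃, hy₁, hy₂, hy₃]
  refine ⟨Matrix.entryLinearMap K H 0 1 ∘ₗ ψ.toLinearMap, fun x y => ?_, fun i hi => ?_, ?_,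
    fun i => ?_, fun i => ?_⟩
  · simp [Matrix.mul_apply, key, add_comm]
  · simp [hψ, hi]
  all_goals simp [hψ]

end IsUniversal
end Universal
end SkewDatum

namespace SkewDatum

universe u

section Operators

variable {K H : Type*} [Field K] [Ring H] [Algebra K H]

/-- Tensor products of endomorphisms acting on the tensor square. -/
noncomputable def tensorEnd (K H : Type*) [Field K] [Ring H] [Algebra K H] :
    Module.End K H ⊗[K] Module.End K H →ₐ[K] Module.End K (H ⊗[K] H) :=
  Algebra.TensorProduct.algHomOfLinearMapTensorProduct
    (TensorProduct.homTensorHomMap (.id K) H H H H)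
    (fun a b c d => by ext; simp) (by ext; simp)

@[simp] theorem tensorEnd_tmul (a b : Module.End K H) (x y : H) :
    tensorEnd K H (a ⊗ₜ b) (x ⊗ₜ y) = a x ⊗ₜ b y := rfl

/-- The value of `t` on products is governed by `τ`. -/
def Leibniz (t : Module.End K H) (τ : Module.End K H ⊗[K] Module.End K H) : Prop :=
  t ∘ₗ LinearMap.mul' K H = LinearMap.mul' K H ∘ₗ tensorEnd K H τ

namespace Leibniz

variable {t t' : Module.End K H} {τ τ' : Module.End K H ⊗[K] Module.End K H}

theorem mul (h : Leibniz t τ) (h' : Leibniz t' τ') : Leibniz (t * t') (τ * τ') := by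
  unfold Leibniz at *
  rw [Module.End.mul_eq_comp, map_mul, Module.End.mul_eq_comp, LinearMap.comp_assoc, h',
    ← LinearMap.comp_assoc, h, LinearMap.comp_assoc]

theorem add (h : Leibniz t τ) (h' : Leibniz t' τ') : Leibniz (t + t') (τ + τ') := by
  unfold Leibniz at *
  rw [map_add, LinearMap.add_comp, LinearMap.comp_add, h, h']

theorem sub (h : Leibniz t τ) (h' : Leibniz t' τ') : Leibniz (t - t') (τ - τ') := by
  unfold Leibniz at *
  rw [map_sub, LinearMap.sub_comp, LinearMap.comp_sub, h, h']

theorem smul (k : K) (h : Leibniz t τ) : Leibniz (k • t) (k • τ) := by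
  unfold Leibniz at *
  rw [map_smul, LinearMap.smul_comp, LinearMap.comp_smul, h]

theorem qComm (q : K) (h : Leibniz t τ) (h' : Leibniz t' τ') :
    Leibniz (qComm q t t') (qComm q τ τ') :=
  (h.mul h').sub ((h'.mul h).smul q)

theorem qSerre (r s : K) (h : Leibniz t τ) (h' : Leibniz t' τ') :
    Leibniz (qSerre r s t t') (qSerre r s τ τ') :=
  (((h.mul h).mul h').sub (((h.mul h').mul h).smul _)).add (((h'.mul h).mul h).smul _)

theorem of_algHom (φ : H →ₐ[K] H) :
    Leibniz φ.toLinearMap (φ.toLinearMap ⊗ₜ[K] φ.toLinearMap) := by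
  unfold Leibniz
  ext x y
  simp

theorem of_skewDerivation {φ : H →ₐ[K] H} {δ : H →ₗ[K] H}
    (hδ : ∀ x y, δ (x * y) = δ x * y + φ x * δ y) :
    Leibniz δ (δ ⊗ₜ[K] (1 : Module.End K H) + φ.toLinearMap ⊗ₜ[K] δ) := by
  unfold Leibniz
  ext x y
  simp [hδ]

end Leibniz

end Operators

namespace IsUniversal

variable {ι K : Type u} [Field K] {D : SkewDatum ι K} {H : Type u} [Ring H] [Algebra K H]
  {E W V : ι → H}

theorem eq_zero_of_leibniz (h : D.IsUniversal E W V) {t g g' : Module.End K H}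
    (ht : Leibniz t (t ⊗ₜ[K] g + g' ⊗ₜ[K] t)) (h₁ : t 1 = 0) (hE : ∀ i, t (E i) = 0)
    (hW : ∀ i, t (W i) = 0) (hV : ∀ i, t (V i) = 0) : t = 0 := by
  ext x
  refine h.induction (P := fun x => t x = 0) (fun k => ?_) hE hW hV (fun x y hx hy => ?_)
    (fun x y hx hy => ?_) x
  · rw [Algebra.algebraMap_eq_smul_one, map_smul, h₁, smul_zero]
  · rw [map_add, hx, hy, add_zero]
  · have := LinearMap.congr_fun ht (x ⊗ₜ y)
    simpa [hx, hy] using this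

/-- Twisting automorphisms and skew derivations by which the Borel algebra of `D` acts on the
universal algebra of `D.dual`. -/
structure IsAction (D : SkewDatum ι K) (F X Y : ι → H) (κ : K) (φ χ : ι → H →ₐ[K] H)
    (δ : ι → H →ₗ[K] H) : Prop where
  twist : ∀ j i, φ j (F i) = F i ∧ φ j (X i) = D.c i j • X i ∧ φ j (Y i) = (D.c i j)⁻¹ • Y i
  untwist : ∀ j i, χ j (F i) = F i ∧ χ j (X i) = (D.c i j)⁻¹ • X i ∧ χ j (Y i) = D.c i j • Y i
  skew : ∀ j x y, δ j (x * y) = δ j x * y + φ j x * δ j y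
  root_of_ne : ∀ {i j}, i ≠ j → δ j (F i) = 0
  root : ∀ j, δ j (F j) = κ • X j
  torus : ∀ j i, δ j (X i) = 0
  torus_inv : ∀ j i, δ j (Y i) = 0

theorem exists_isAction {F X Y : ι → H} (h : D.dual.IsUniversal F X Y) (κ : K) :
    ∃ φ χ δ, IsAction D F X Y κ φ χ δ := by
  choose φ hφ using fun j => h.exists_twist (t := fun i => D.c i j) fun i => D.c_ne i j
  choose χ hχ using fun j => h.exists_twist (t := fun i => (D.c i j)⁻¹)
    fun i => inv_ne_zero (D.c_ne i j)
  choose δ h₁ h₂ h₃ h₄ h₅ using fun j => h.exists_skewDerivation j κ (hφ j)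
  exact ⟨φ, χ, δ, hφ, by simpa using hχ, h₁, fun {i j} => h₂ j i, h₃, h₄, h₅⟩

namespace IsAction

variable {F X Y : ι → H} {κ : K} {φ χ : ι → H →ₐ[K] H} {δ : ι → H →ₗ[K] H}

theorem skew_one (h : IsAction D F X Y κ φ χ δ) (j : ι) : δ j 1 = 0 := by
  simpa using h.skew j 1 1

theorem skew_skew_root (h : IsAction D F X Y κ φ χ δ) (i j k : ι) : δ i (δ j (F k)) = 0 := by
  by_cases hk : k = j
  · rw [hk, h.root, map_smul, h.torus, smul_zero]
  · rw [h.root_of_ne hk, map_zero]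

theorem twist_skew (h : IsAction D F X Y κ φ χ δ) (hU : D.dual.IsUniversal F X Y) (i j : ι) :
    (φ j).toLinearMap * δ i = D.c i j • (δ i * (φ j).toLinearMap) := by
  have hφ : (φ j).toLinearMap * (φ i).toLinearMap = (φ i).toLinearMap * (φ j).toLinearMap := by
    have : (φ j).comp (φ i) = (φ i).comp (φ j) := by
      apply hU.hom_ext <;> intro k <;> simp [h.twist, smul_comm (D.c k i),
        smul_comm (D.c k i)⁻¹]
    exact congrArg AlgHom.toLinearMap this
  rw [← sub_eq_zero]
  have := ((Leibniz.of_algHom (φ j)).mul (.of_skewDerivation (h.skew i))).sub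
    (((Leibniz.of_skewDerivation (h.skew i)).mul (.of_algHom (φ j))).smul (D.c i j))
  apply hU.eq_zero_of_leibniz (g := (φ j).toLinearMap)
    (g' := (φ j).toLinearMap * (φ i).toLinearMap)
  · convert this using 2
    simp only [mul_add, add_mul,
      Algebra.TensorProduct.tmul_mul_tmul, one_mul, mul_one, hφ, TensorProduct.sub_tmul,
      TensorProduct.tmul_sub, smul_add, TensorProduct.smul_tmul', TensorProduct.tmul_smul]
    abel
  · simp [h.skew_one]
  · intro k
    by_cases hk : k = i
    · simp [hk, h.root, h.twist, smul_comm κ]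
    · simp [h.root_of_ne hk, h.twist]
  · intro k; simp [h.twist, h.torus]
  · intro k; simp [h.twist, h.torus_inv]

theorem isRep (h : IsAction D F X Y κ φ χ δ) (hU : D.dual.IsUniversal F X Y) :
    D.IsRep (A := Module.End K H) δ (fun j => (φ j).toLinearMap) (fun j => (χ j).toLinearMap) := by
  have hφχ (j : ι) : (φ j).comp (χ j) = AlgHom.id K H := by
    apply hU.hom_ext <;> intro k <;> simp [h.twist, h.untwist, D.c_ne k j]
  have hχφ (j : ι) : (χ j).comp (φ j) = AlgHom.id K H := by
    apply hU.hom_ext <;> intro k <;> simp [h.twist, h.untwist, D.c_ne k j]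
  have hφ (i j : ι) :
      (φ i).toLinearMap * (φ j).toLinearMap = (φ j).toLinearMap * (φ i).toLinearMap := by
    have : (φ i).comp (φ j) = (φ j).comp (φ i) := by
      apply hU.hom_ext <;> intro k <;> simp [h.twist, smul_comm (D.c k i),
        smul_comm (D.c k i)⁻¹]
    exact congrArg AlgHom.toLinearMap this
  have hc (i j : ι) : (φ j).toLinearMap ⊗ₜ[K] δ j * δ i ⊗ₜ[K] (1 : Module.End K H) =
      D.c i j • (δ i ⊗ₜ[K] (1 : Module.End K H) * (φ j).toLinearMap ⊗ₜ[K] δ j) := by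
    simp [h.twist_skew hU, TensorProduct.smul_tmul']
  refine ⟨fun j => congrArg AlgHom.toLinearMap (hφχ j),
    fun j => congrArg AlgHom.toLinearMap (hχφ j),
    hφ, h.twist_skew hU, fun {i j} hij => ?_, fun {i j} hij => ?_, fun {i j} hij => ?_⟩
  · apply hU.eq_zero_of_leibniz (g := 1) (g' := (φ i).toLinearMap * (φ j).toLinearMap)
    · have := (Leibniz.of_skewDerivation (h.skew i)).qComm (D.c j i)
        (Leibniz.of_skewDerivation (h.skew j))
      rw [← qComm_tmul_one, ← qComm_tmul _ (hφ i j),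
        ← qComm_add (D.c_ne j i) (hc j i) (by rw [hc, D.c_orth hij])]
      exact this
    · simp [qComm, h.skew_one]
    · simp [qComm, h.skew_skew_root]
    · simp [qComm, h.torus]
    · simp [qComm, h.torus_inv]
  · apply hU.eq_zero_of_leibniz (g := 1)
      (g' := (φ i).toLinearMap * (φ i).toLinearMap * (φ j).toLinearMap)
    · have := (Leibniz.of_skewDerivation (h.skew i)).qSerre D.r D.s
        (Leibniz.of_skewDerivation (h.skew j))
      rw [← qSerre_tmul_one, ← qSerre_tmul _ _ (hφ i j),
        ← qSerre_add D.r_ne D.s_ne (by rw [hc, D.c_self]) (by rw [hc, D.c_adj' hij])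
          (by rw [hc, D.c_adj hij])]
      exact this
    · simp [qSerre, h.skew_one]
    · simp [qSerre, h.skew_skew_root]
    · simp [qSerre, h.torus]
    · simp [qSerre, h.torus_inv]
  · apply hU.eq_zero_of_leibniz (g := 1)
      (g' := (φ j).toLinearMap * (φ j).toLinearMap * (φ i).toLinearMap)
    · have := (Leibniz.of_skewDerivation (h.skew j)).qSerre D.r⁻¹ D.s⁻¹
        (Leibniz.of_skewDerivation (h.skew i))
      rw [← qSerre_tmul_one, ← qSerre_tmul _ _ (hφ j i),
        ← qSerre_add' D.r_ne D.s_ne (by rw [hc, D.c_self]) (by rw [hc, D.c_adj' hij])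
          (by rw [hc, D.c_adj hij])]
      exact this
    · simp [qSerre, h.skew_one]
    · simp [qSerre, h.skew_skew_root]
    · simp [qSerre, h.torus]
    · simp [qSerre, h.torus_inv]

end IsAction
end IsUniversal
end SkewDatum

namespace SkewDatum

universe u

variable {ι K : Type u} [Field K] {D : SkewDatum ι K} {H H' : Type u} [Ring H] [Algebra K H]
  [Ring H'] [Algebra K H'] {E W V : ι → H} {F X Y : ι → H'}

/-- A skew-dual pairing with the values on generators prescribed by `D` and `κ`. -/
structure IsSkewPairing [DecidableEq ι] (D : SkewDatum ι K) (E W V : ι → H) (F X Y : ι → H')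
    (Δ : H →ₐ[K] H ⊗[K] H) (ε : H →ₐ[K] K) (Δ' : H' →ₐ[K] H' ⊗[K] H') (ε' : H' →ₐ[K] K) (κ : K)
    (p : H' →ₗ[K] H →ₗ[K] K) : Prop where
  map_one : ∀ f, p f 1 = ε' f
  one_map : ∀ a, p 1 a = ε a
  map_mul : ∀ f a a', p f (a * a') =
    LinearMap.mul' K K (TensorProduct.map (p.flip a') (p.flip a) (Δ' f))
  mul_map : ∀ f f' a, p (f * f') a = LinearMap.mul' K K (TensorProduct.map (p f) (p f') (Δ a))
  root_root : ∀ i j, p (F i) (E j) = if i = j then κ else 0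
  torus_torus : ∀ i j, p (X i) (W j) = D.c i j
  torus_inv : ∀ i j, p (X i) (V j) = (D.c i j)⁻¹
  inv_torus : ∀ i j, p (Y i) (W j) = (D.c i j)⁻¹
  inv_inv : ∀ i j, p (Y i) (V j) = D.c i j
  root_torus : ∀ i j, p (F i) (W j) = 0
  root_inv : ∀ i j, p (F i) (V j) = 0
  torus_root : ∀ i j, p (X i) (E j) = 0
  inv_root : ∀ i j, p (Y i) (E j) = 0

/-- `Δ` and `ε` take the standard values on generators. -/
structure IsBialgebra (E W V : ι → H) (Δ : H →ₐ[K] H ⊗[K] H) (ε : H →ₐ[K] K) : Prop where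
  comul : ∀ i, Δ (W i) = W i ⊗ₜ W i ∧ Δ (V i) = V i ⊗ₜ V i ∧ Δ (E i) = E i ⊗ₜ 1 + W i ⊗ₜ E i
  counit : ∀ i, ε (W i) = 1 ∧ ε (V i) = 1 ∧ ε (E i) = 0

/-- `Δ` and `ε` take the standard values on generators, for the opposite Borel algebra. -/
structure IsBialgebraSwap (E W V : ι → H) (Δ : H →ₐ[K] H ⊗[K] H) (ε : H →ₐ[K] K) : Prop where
  comul : ∀ i, Δ (W i) = W i ⊗ₜ W i ∧ Δ (V i) = V i ⊗ₜ V i ∧ Δ (E i) = 1 ⊗ₜ E i + E i ⊗ₜ W i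
  counit : ∀ i, ε (W i) = 1 ∧ ε (V i) = 1 ∧ ε (E i) = 0

variable {Δ : H →ₐ[K] H ⊗[K] H} {ε : H →ₐ[K] K} {Δ' : H' →ₐ[K] H' ⊗[K] H'} {ε' : H' →ₐ[K] K}
  {κ : K}

section Existence

namespace IsUniversal.IsAction

variable {φ χ : ι → H' →ₐ[K] H'} {δ : ι → H' →ₗ[K] H'} {R : H →ₐ[K] Module.End K H'}

theorem act_one (h : IsAction D F X Y κ φ χ δ) (hH : D.IsUniversal E W V)
    (hB : IsBialgebra E W V Δ ε)
    (hR : ∀ i, R (E i) = δ i ∧ R (W i) = (φ i).toLinearMap ∧ R (V i) = (χ i).toLinearMap)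
    (a : H) : R a 1 = ε a • 1 := by
  refine hH.induction (P := fun a => R a 1 = ε a • 1) (fun k => ?_) (fun i => ?_) (fun i => ?_)
    (fun i => ?_) (fun x y hx hy => ?_) (fun x y hx hy => ?_) a
  · simp [Algebra.algebraMap_eq_smul_one]
  · simp [hR, hB.counit, h.skew_one]
  · simp [hR, hB.counit]
  · simp [hR, hB.counit]
  · simp [hx, hy, add_smul]
  · simp [hx, hy, mul_smul, smul_comm (ε x)]

theorem comul_act (h : IsAction D F X Y κ φ χ δ) (hH : D.IsUniversal E W V)
    (hH' : D.dual.IsUniversal F X Y) (hB' : IsBialgebraSwap F X Y Δ' ε')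
    (hR : ∀ i, R (E i) = δ i ∧ R (W i) = (φ i).toLinearMap ∧ R (V i) = (χ i).toLinearMap)
    (a : H) (f : H') : Δ' (R a f) = TensorProduct.map (R a) LinearMap.id (Δ' f) := by
  have hφ (ψ : H' →ₐ[K] H') {t : ι → K}
      (hψ : ∀ i, ψ (F i) = F i ∧ ψ (X i) = t i • X i ∧ ψ (Y i) = (t i)⁻¹ • Y i) (f : H') :
      Δ' (ψ f) = TensorProduct.map ψ.toLinearMap LinearMap.id (Δ' f) := by
    have : Δ'.comp ψ = (Algebra.TensorProduct.map ψ (AlgHom.id K H')).comp Δ' := by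
      apply hH'.hom_ext <;> intro i <;>
        simp [hψ, hB'.comul, TensorProduct.smul_tmul']
    exact DFunLike.congr_fun this f
  revert f
  refine hH.induction (P := fun a => ∀ f, Δ' (R a f) =
    TensorProduct.map (R a) LinearMap.id (Δ' f)) (fun k f => ?_) (fun j f => ?_) (fun i => ?_)
    (fun i => ?_) (fun x y hx hy f => ?_) (fun x y hx hy f => ?_) a
  · have : R (algebraMap K H k) = k • LinearMap.id := by
      simp [Algebra.algebraMap_eq_smul_one]; rfl
    rw [this, TensorProduct.map_smul_left]
    simp
  · rw [(hR j).1]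
    have hmul (t t' : H' ⊗[K] H') : TensorProduct.map (δ j) LinearMap.id (t * t') =
        TensorProduct.map (δ j) LinearMap.id t * t' +
        TensorProduct.map (φ j).toLinearMap LinearMap.id t *
          TensorProduct.map (δ j) LinearMap.id t' := by
      induction t with
      | zero => simp
      | add t₁ t₂ h₁ h₂ => simp only [add_mul, map_add, h₁, h₂]; abel
      | tmul x y =>
        induction t' with
        | zero => simp
        | add t₁ t₂ h₁ h₂ => simp only [mul_add, map_add, h₁, h₂]; abel
        | tmul x' y' => simp [h.skew, TensorProduct.add_tmul]
    refine hH'.induction (P := fun f => Δ' (δ j f) =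
      TensorProduct.map (δ j) LinearMap.id (Δ' f)) (fun k => ?_) (fun i => ?_) (fun i => ?_)
      (fun i => ?_) (fun x y hx hy => ?_) (fun x y hx hy => ?_) f
    · simp [Algebra.algebraMap_eq_smul_one, h.skew_one, Algebra.TensorProduct.one_def]
    · by_cases hij : i = j
      · subst hij
        simp [h.root, hB'.comul, h.skew_one, TensorProduct.smul_tmul']
      · simp [h.root_of_ne hij, hB'.comul, h.skew_one]
    · simp [h.torus, hB'.comul]
    · simp [h.torus_inv, hB'.comul]
    · simp [hx, hy]
    · rw [h.skew, map_add, map_mul, map_mul, map_mul, hx, hy, hφ _ (h.twist j), hmul]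
  · rw [(hR i).2.1]; exact hφ _ (h.twist i)
  · rw [(hR i).2.2]; exact hφ _ (t := fun j => (D.c j i)⁻¹) (by simpa using h.untwist i)
  · simp [hx, hy, TensorProduct.map_add_left]
  · rw [map_mul, Module.End.mul_apply, hx, hy, Module.End.mul_eq_comp,
      ← LinearMap.comp_apply, ← TensorProduct.map_comp, LinearMap.id_comp]

theorem leibniz_act (h : IsAction D F X Y κ φ χ δ) (hH : D.IsUniversal E W V)
    (hB : IsBialgebra E W V Δ ε)
    (hR : ∀ i, R (E i) = δ i ∧ R (W i) = (φ i).toLinearMap ∧ R (V i) = (χ i).toLinearMap)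
    (a : H) : Leibniz (R a) (Algebra.TensorProduct.map R R (Δ a)) := by
  refine hH.induction (P := fun a => Leibniz (R a) (Algebra.TensorProduct.map R R (Δ a)))
    (fun k => ?_) (fun i => ?_) (fun i => ?_)
    (fun i => ?_) (fun x y hx hy => ?_) (fun x y hx hy => ?_) a
  · simp only [AlgHom.commutes]
    unfold Leibniz
    ext x y
    simp [Algebra.algebraMap_eq_smul_one]
  · simp only [hB.comul, map_add, Algebra.TensorProduct.map_tmul, hR, map_one]
    exact .of_skewDerivation (h.skew i)
  · simp only [hB.comul, Algebra.TensorProduct.map_tmul, hR]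
    exact .of_algHom _
  · simp only [hB.comul, Algebra.TensorProduct.map_tmul, hR]
    exact .of_algHom _
  · simp only [map_add]; exact hx.add hy
  · simp only [map_mul]; exact hx.mul hy

end IsUniversal.IsAction

theorem IsBialgebraSwap.counit_comul (hB' : IsBialgebraSwap F X Y Δ' ε')
    (hH' : D.IsUniversal F X Y) (f : H') :
    TensorProduct.lid K H' (TensorProduct.map ε'.toLinearMap LinearMap.id (Δ' f)) = f := by
  have : ((Algebra.TensorProduct.lid K H' : K ⊗[K] H' →ₐ[K] H').comp
      (Algebra.TensorProduct.map ε' (AlgHom.id K H'))).comp Δ' = AlgHom.id K H' := by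
    apply hH'.hom_ext <;> intro i <;> simp [hB'.comul, hB'.counit]
  exact DFunLike.congr_fun this f

theorem exists_isSkewPairing [DecidableEq ι] (hH : D.IsUniversal E W V)
    (hH' : D.dual.IsUniversal F X Y) (hB : IsBialgebra E W V Δ ε)
    (hB' : IsBialgebraSwap F X Y Δ' ε') (κ : K) :
    ∃ p, IsSkewPairing D E W V F X Y Δ ε Δ' ε' κ p := by
  obtain ⟨φ, χ, δ, h⟩ := hH'.exists_isAction κ
  obtain ⟨R, hR⟩ := hH.lift (h.isRep hH')
  let p : H' →ₗ[K] H →ₗ[K] K := (R.toLinearMap.compr₂ ε'.toLinearMap).flip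
  have hp (f : H') (a : H) : p f a = ε' (R a f) := rfl
  refine ⟨p, fun f => ?_, fun a => ?_, fun f a a' => ?_, fun f f' a => ?_, fun i j => ?_,
    fun i j => ?_, fun i j => ?_, fun i j => ?_, fun i j => ?_, fun i j => ?_, fun i j => ?_,
    fun i j => ?_, fun i j => ?_⟩
  · simp [hp]
  · simp [hp, h.act_one hH hB hR]
  · rw [hp, map_mul, Module.End.mul_apply, ← hB'.counit_comul hH' (R a' f),
      h.comul_act hH hH' hB' hR]
    generalize Δ' f = t
    induction t with
    | zero => simp
    | add t₁ t₂ h₁ h₂ => simp only [map_add, h₁, h₂]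
    | tmul x y => simp [hp]
  · have := LinearMap.congr_fun (h.leibniz_act hH hB hR a) (f ⊗ₜ f')
    simp only [LinearMap.comp_apply, LinearMap.mul'_apply] at this
    rw [hp, this]
    generalize Δ a = t
    induction t with
    | zero => simp
    | add t₁ t₂ h₁ h₂ => simp only [map_add, LinearMap.add_apply, h₁, h₂]
    | tmul x y => simp [hp]
  · split_ifs with hij
    · subst hij; simp [hp, hR, h.root, hB'.counit]
    · simp [hp, hR, h.root_of_ne hij]
  all_goals simp [hp, hR, h.twist, h.untwist, h.torus, h.torus_inv, hB'.counit]

end Existence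
end SkewDatum

namespace SkewDatum

universe u

variable {ι K : Type u} [Field K] {D : SkewDatum ι K} {H H' : Type u} [Ring H] [Algebra K H]
  [Ring H'] [Algebra K H'] {E W V : ι → H} {F X Y : ι → H'}
  {Δ : H →ₐ[K] H ⊗[K] H} {ε : H →ₐ[K] K} {Δ' : H' →ₐ[K] H' ⊗[K] H'} {ε' : H' →ₐ[K] K} {κ : K}

section Uniqueness

theorem IsSkewPairing.unique [DecidableEq ι] {p p' : H' →ₗ[K] H →ₗ[K] K}
    (hp : IsSkewPairing D E W V F X Y Δ ε Δ' ε' κ p)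
    (hp' : IsSkewPairing D E W V F X Y Δ ε Δ' ε' κ p') (hH : D.IsUniversal E W V)
    (hH' : D.dual.IsUniversal F X Y) (hB : IsBialgebra E W V Δ ε) : p = p' := by
  have scalar (k : K) (a : H) : p (algebraMap K H' k) a = p' (algebraMap K H' k) a := by
    simp [Algebra.algebraMap_eq_smul_one, hp.one_map, hp'.one_map]
  have hW (i : ι) (f : H') : p f (W i) = p' f (W i) := by
    refine hH'.induction (P := fun f => p f (W i) = p' f (W i)) (fun k => scalar k _) (fun j => ?_)
      (fun j => ?_) (fun j => ?_) (fun x y hx hy => ?_) (fun x y hx hy => ?_) f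
    · rw [hp.root_torus, hp'.root_torus]
    · rw [hp.torus_torus, hp'.torus_torus]
    · rw [hp.inv_torus, hp'.inv_torus]
    · simp [hx, hy]
    · simp [hp.mul_map, hp'.mul_map, hB.comul, hx, hy]
  have hV (i : ι) (f : H') : p f (V i) = p' f (V i) := by
    refine hH'.induction (P := fun f => p f (V i) = p' f (V i)) (fun k => scalar k _) (fun j => ?_)
      (fun j => ?_) (fun j => ?_) (fun x y hx hy => ?_) (fun x y hx hy => ?_) f
    · rw [hp.root_inv, hp'.root_inv]
    · rw [hp.torus_inv, hp'.torus_inv]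
    · rw [hp.inv_inv, hp'.inv_inv]
    · simp [hx, hy]
    · simp [hp.mul_map, hp'.mul_map, hB.comul, hx, hy]
  have hE (i : ι) (f : H') : p f (E i) = p' f (E i) := by
    refine hH'.induction (P := fun f => p f (E i) = p' f (E i)) (fun k => scalar k _) (fun j => ?_)
      (fun j => ?_) (fun j => ?_) (fun x y hx hy => ?_) (fun x y hx hy => ?_) f
    · rw [hp.root_root, hp'.root_root]
    · rw [hp.torus_root, hp'.torus_root]
    · rw [hp.inv_root, hp'.inv_root]
    · simp [hx, hy]
    · simp [hp.mul_map, hp'.mul_map, hB.comul, hx, hy, hW, hp.map_one, hp'.map_one]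
  have key (a : H) : p.flip a = p'.flip a := by
    refine hH.induction (P := fun a => p.flip a = p'.flip a) (fun k => ?_)
      (fun j => LinearMap.ext (hE j)) (fun j => LinearMap.ext (hW j))
      (fun j => LinearMap.ext (hV j)) (fun x y hx hy => ?_) (fun x y hx hy => ?_) a
    · ext f
      simp [Algebra.algebraMap_eq_smul_one, hp.map_one, hp'.map_one]
    · rw [map_add, map_add, hx, hy]
    · ext f
      simp only [LinearMap.flip_apply]
      rw [hp.map_mul, hp'.map_mul, hx, hy]
  exact LinearMap.ext₂ fun f a => LinearMap.congr_fun (key a) f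

end Uniqueness

section Antipode

/-- `S` is an antihomomorphism taking the standard antipode values on generators. -/
structure IsAntipode (E W V : ι → H) (S : H →ₗ[K] H) : Prop where
  map_one : S 1 = 1
  map_mul : ∀ x y, S (x * y) = S y * S x
  gens : ∀ i, S (W i) = V i ∧ S (V i) = W i ∧ S (E i) = -(V i * E i)

/-- The analogue of `IsAntipode` for the opposite Borel algebra. -/
structure IsAntipodeSwap (E W V : ι → H) (S : H →ₗ[K] H) : Prop where
  map_one : S 1 = 1
  map_mul : ∀ x y, S (x * y) = S y * S x
  gens : ∀ i, S (W i) = V i ∧ S (V i) = W i ∧ S (E i) = -(E i * V i)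

theorem IsUniversal.counit_antihom (h : D.IsUniversal E W V) {S : H →ₗ[K] H} (h₁ : S 1 = 1)
    (hmul : ∀ x y, S (x * y) = S y * S x) (hE : ∀ i, ε (S (E i)) = ε (E i))
    (hW : ∀ i, ε (S (W i)) = ε (W i)) (hV : ∀ i, ε (S (V i)) = ε (V i)) (x : H) :
    ε (S x) = ε x := by
  refine h.induction (P := fun x => ε (S x) = ε x) (fun k => ?_) hE hW hV
    (fun x y hx hy => ?_) (fun x y hx hy => ?_) x
  · simp [Algebra.algebraMap_eq_smul_one, h₁]
  · simp [hx, hy]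
  · rw [hmul, map_mul, map_mul, hx, hy, mul_comm]

theorem IsUniversal.comul_antihom (h : D.IsUniversal E W V) {S : H →ₗ[K] H} (h₁ : S 1 = 1)
    (hmul : ∀ x y, S (x * y) = S y * S x)
    (hE : ∀ i, Δ (S (E i)) = TensorProduct.map S S (TensorProduct.comm K H H (Δ (E i))))
    (hW : ∀ i, Δ (S (W i)) = TensorProduct.map S S (TensorProduct.comm K H H (Δ (W i))))
    (hV : ∀ i, Δ (S (V i)) = TensorProduct.map S S (TensorProduct.comm K H H (Δ (V i)))) (x : H) :
    Δ (S x) = TensorProduct.map S S (TensorProduct.comm K H H (Δ x)) := by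
  have key (t t' : H ⊗[K] H) : TensorProduct.map S S (TensorProduct.comm K H H (t * t')) =
      TensorProduct.map S S (TensorProduct.comm K H H t') *
        TensorProduct.map S S (TensorProduct.comm K H H t) := by
    induction t with
    | zero => simp
    | add t₁ t₂ h₁ h₂ => simp only [add_mul, mul_add, map_add, h₁, h₂]
    | tmul x y =>
      induction t' with
      | zero => simp
      | add t₁ t₂ h₁ h₂ => simp only [add_mul, mul_add, map_add, h₁, h₂]
      | tmul x' y' => simp [hmul]
  refine h.induction (P := fun x => Δ (S x) =
      TensorProduct.map S S (TensorProduct.comm K H H (Δ x))) (fun k => ?_) hE hW hV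
    (fun x y hx hy => ?_) (fun x y hx hy => ?_) x
  · simp [Algebra.algebraMap_eq_smul_one, h₁, Algebra.TensorProduct.one_def]
  · simp only [map_add, hx, hy]
  · rw [hmul, map_mul, map_mul, hx, hy, key]

namespace IsAntipode

variable {S : H →ₗ[K] H}

theorem counit (hS : IsAntipode E W V S) (h : D.IsUniversal E W V) (hB : IsBialgebra E W V Δ ε)
    (x : H) : ε (S x) = ε x := by
  apply h.counit_antihom hS.map_one hS.map_mul <;> intro i <;> simp [hS.gens, hB.counit]

theorem comul (hS : IsAntipode E W V S) (h : D.IsUniversal E W V) (hB : IsBialgebra E W V Δ ε)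
    (x : H) : Δ (S x) = TensorProduct.map S S (TensorProduct.comm K H H (Δ x)) := by
  apply h.comul_antihom hS.map_one hS.map_mul <;> intro i
  · simp [hS.gens, hB.comul, hS.map_one, mul_add, h.rep.inv_mul, TensorProduct.neg_tmul,
      TensorProduct.tmul_neg, add_comm]
  · simp [hS.gens, hB.comul]
  · simp [hS.gens, hB.comul]

end IsAntipode

namespace IsAntipodeSwap

variable {S : H →ₗ[K] H}

theorem counit (hS : IsAntipodeSwap E W V S) (h : D.IsUniversal E W V)
    (hB : IsBialgebraSwap E W V Δ ε) (x : H) : ε (S x) = ε x := by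
  apply h.counit_antihom hS.map_one hS.map_mul <;> intro i <;> simp [hS.gens, hB.counit]

theorem comul (hS : IsAntipodeSwap E W V S) (h : D.IsUniversal E W V)
    (hB : IsBialgebraSwap E W V Δ ε) (x : H) :
    Δ (S x) = TensorProduct.map S S (TensorProduct.comm K H H (Δ x)) := by
  apply h.comul_antihom hS.map_one hS.map_mul <;> intro i
  · simp [hS.gens, hB.comul, hS.map_one, add_mul, h.rep.mul_inv, TensorProduct.neg_tmul,
      TensorProduct.tmul_neg, add_comm]
  · simp [hS.gens, hB.comul]
  · simp [hS.gens, hB.comul]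

end IsAntipodeSwap

variable {S : H →ₗ[K] H} {S' : H' →ₗ[K] H'} {p : H' →ₗ[K] H →ₗ[K] K}

theorem IsSkewPairing.antipode [DecidableEq ι] (hp : IsSkewPairing D E W V F X Y Δ ε Δ' ε' κ p)
    (hH : D.IsUniversal E W V) (hH' : D.dual.IsUniversal F X Y) (hB : IsBialgebra E W V Δ ε)
    (hB' : IsBialgebraSwap F X Y Δ' ε') (hS : IsAntipode E W V S)
    (hS' : IsAntipodeSwap F X Y S') :
    IsSkewPairing D E W V F X Y Δ ε Δ' ε' κ (p.compl₁₂ S' S) := by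
  refine ⟨fun f => ?_, fun a => ?_, fun f a a' => ?_, fun f f' a => ?_, fun i j => ?_,
    fun i j => ?_, fun i j => ?_, fun i j => ?_, fun i j => ?_, fun i j => ?_, fun i j => ?_,
    fun i j => ?_, fun i j => ?_⟩
  · simp [hS.map_one, hp.map_one, hS'.counit hH' hB']
  · simp [hS'.map_one, hp.one_map, hS.counit hH hB]
  · rw [LinearMap.compl₁₂_apply, hS.map_mul, hp.map_mul, hS'.comul hH' hB']
    generalize Δ' f = t
    induction t with
    | zero => simp
    | add t₁ t₂ h₁ h₂ => simp only [map_add, h₁, h₂]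
    | tmul x y => simp [mul_comm]
  · rw [LinearMap.compl₁₂_apply, hS'.map_mul, hp.mul_map, hS.comul hH hB]
    generalize Δ a = t
    induction t with
    | zero => simp
    | add t₁ t₂ h₁ h₂ => simp only [map_add, h₁, h₂]
    | tmul x y => simp [mul_comm]
  · have h₁ : p (F i) (V j * E j) = if i = j then κ * (D.c i j)⁻¹ else 0 := by
      simp [hp.map_mul, hB'.comul, hp.one_map, hB.counit, hp.root_root, hp.torus_inv]
    simp only [LinearMap.compl₁₂_apply, hS.gens, hS'.gens, map_neg, LinearMap.neg_apply, neg_neg]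
    simp only [hp.mul_map, _root_.map_mul, hB.comul, mul_add, Algebra.TensorProduct.tmul_mul_tmul,
      mul_one, map_add, TensorProduct.map_tmul, LinearMap.mul'_apply, h₁, hH.rep.inv_mul,
      hp.map_one, hB'.counit, zero_mul, add_zero, hp.inv_inv]
    split_ifs
    · rw [mul_assoc, inv_mul_cancel₀ (D.c_ne i j), mul_one]
    · rw [zero_mul]
  all_goals simp [hS.gens, hS'.gens, hp.torus_torus, hp.torus_inv, hp.inv_torus, hp.inv_inv,
    hp.root_torus, hp.root_inv, hp.torus_root, hp.inv_root, hp.mul_map, hp.map_mul, hB.comul,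
    hB'.comul]

theorem IsSkewPairing.antipode_apply [DecidableEq ι]
    (hp : IsSkewPairing D E W V F X Y Δ ε Δ' ε' κ p)
    (hH : D.IsUniversal E W V) (hH' : D.dual.IsUniversal F X Y) (hB : IsBialgebra E W V Δ ε)
    (hB' : IsBialgebraSwap F X Y Δ' ε') (hS : IsAntipode E W V S)
    (hS' : IsAntipodeSwap F X Y S') (f : H') (a : H) : p (S' f) (S a) = p f a :=
  LinearMap.congr_fun₂ ((hp.antipode hH hH' hB hB' hS hS').unique hp hH hH' hB) f a

end Antipode
end SkewDatum

theorem qr_ne_zero : qr ≠ 0 := by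
  unfold qr
  simp [MvPolynomial.X_ne_zero]

theorem qs_ne_zero : qs ≠ 0 := by
  unfold qs
  simp [MvPolynomial.X_ne_zero]

theorem apaD_of_lt {n i j : ℕ} (hi : i < n + 1) :
    apaD n i j = ipaD n i j - ipaD n (i + 1) j := by
  have (k : ℕ) : ipaD n k i * ipaD n k j =
      (if k = i then ipaD n k j else 0) - (if k = i + 1 then ipaD n k j else 0) := by
    have : ipaD n k i = (if k = i then 1 else 0) - (if k = i + 1 then 1 else 0) := if_pos hi
    simp only [this, sub_mul, ite_mul, one_mul, zero_mul]
  simp only [apaD, this, Finset.sum_sub_distrib, Finset.sum_ite_eq', Finset.mem_range]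
  rw [if_pos (by omega), if_pos (by omega)]

/-- The exponent of `r` in the pairing values. -/
def cstExpR (n i j : ℕ) : ℤ :=
  if j < n + 1 then ipaD n j i else if i ≠ n then ipaD n n i else ipaD n (n + 1) i

/-- The exponent of `s` in the pairing values. -/
def cstExpS (n i j : ℕ) : ℤ :=
  if j < n + 1 then ipaD n (j + 1) i else if i ≠ n then -ipaD n (n + 1) i else -ipaD n n i

theorem cstD_eq (n : ℕ) (i j : Fin (n + 2)) :
    cstD n i j = qr ^ cstExpR n i j * qs ^ cstExpS n i j := by
  unfold cstD cstExpR cstExpS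
  split_ifs <;> rfl

theorem cstD_ne_zero (n : ℕ) (i j : Fin (n + 2)) : cstD n i j ≠ 0 := by
  rw [cstD_eq]
  exact mul_ne_zero (zpow_ne_zero _ qr_ne_zero) (zpow_ne_zero _ qs_ne_zero)

theorem cstD_self (n : ℕ) (i : Fin (n + 2)) : cstD n i i = qr / qs := by
  have h₁ : cstExpR n i i = 1 := by
    unfold cstExpR ipaD; split_ifs <;> omega
  have h₂ : cstExpS n i i = -1 := by
    unfold cstExpS ipaD; split_ifs <;> omega
  rw [cstD_eq, h₁, h₂, zpow_one, zpow_neg_one, div_eq_mul_inv]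

section

variable {n : ℕ} {i j : Fin (n + 2)}

theorem cstD_of_adj (hij : i < j) (ha : apaD n i j = -1) : cstD n i j = qr⁻¹ := by
  have hj := j.isLt
  rw [Fin.lt_def] at hij
  rw [apaD_of_lt (by omega)] at ha
  have h₁ : cstExpR n i j = -1 := by
    unfold cstExpR; unfold ipaD at *; split_ifs at * <;> omega
  have h₂ : cstExpS n i j = 0 := by
    unfold cstExpS; unfold ipaD at *; split_ifs at * <;> omega
  rw [cstD_eq, h₁, h₂, zpow_zero, zpow_neg_one, mul_one]

theorem cstD_of_adj' (hij : i < j) (ha : apaD n i j = -1) : cstD n j i = qs := by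
  have hj := j.isLt
  rw [Fin.lt_def] at hij
  rw [apaD_of_lt (by omega)] at ha
  have h₁ : cstExpR n j i = 0 := by
    unfold cstExpR; unfold ipaD at *; split_ifs at * <;> omega
  have h₂ : cstExpS n j i = 1 := by
    unfold cstExpS; unfold ipaD at *; split_ifs at * <;> omega
  rw [cstD_eq, h₁, h₂, zpow_zero, zpow_one, one_mul]

theorem cstD_of_orth (hij : i < j) (ha : apaD n i j = 0) :
    cstD n i j = (cstD n j i)⁻¹ := by
  have hj := j.isLt
  rw [Fin.lt_def] at hij
  rw [apaD_of_lt (by omega)] at ha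
  have h₁ : cstExpR n i j = -cstExpR n j i := by
    unfold cstExpR; unfold ipaD at *; split_ifs at * <;> omega
  have h₂ : cstExpS n i j = -cstExpS n j i := by
    unfold cstExpS; unfold ipaD at *; split_ifs at * <;> omega
  rw [cstD_eq, cstD_eq, h₁, h₂, zpow_neg, zpow_neg, mul_inv]

theorem cstD_of_orth_of_not (hij : i < j) (ha : apaD n i j = 0)
    (hn : ¬((i : ℕ) = n ∧ (j : ℕ) = n + 1)) : cstD n j i = 1 := by
  have hj := j.isLt
  rw [Fin.lt_def] at hij
  rw [apaD_of_lt (by omega)] at ha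
  have h₁ : cstExpR n j i = 0 := by
    unfold cstExpR; unfold ipaD at *; split_ifs at * <;> omega
  have h₂ : cstExpS n j i = 0 := by
    unfold cstExpS; unfold ipaD at *; split_ifs at * <;> omega
  rw [cstD_eq, h₁, h₂, zpow_zero, zpow_zero, one_mul]

theorem cstD_spin (hi : (i : ℕ) = n) (hj : (j : ℕ) = n + 1) : cstD n j i = qr * qs := by
  have h₁ : cstExpR n j i = 1 := by
    unfold cstExpR ipaD; split_ifs <;> omega
  have h₂ : cstExpS n j i = 1 := by
    unfold cstExpS ipaD; split_ifs <;> omega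
  rw [cstD_eq, h₁, h₂, zpow_one, zpow_one]

theorem apaD_comm (n i j : ℕ) : apaD n i j = apaD n j i := by
  simp only [apaD, mul_comm]

theorem apaD_spin (hi : (i : ℕ) = n) (hj : (j : ℕ) = n + 1) : apaD n i j = 0 := by
  rw [apaD_of_lt (by omega)]
  unfold ipaD
  split_ifs <;> omega

end

/-- The datum of type `D` and rank `n + 2`. -/
noncomputable def datumD (n : ℕ) : SkewDatum (Fin (n + 2)) KK where
  r := qr
  s := qs
  c := cstD n
  orth i j := i < j ∧ apaD n i j = 0
  adj i j := i < j ∧ apaD n i j = -1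
  r_ne := qr_ne_zero
  s_ne := qs_ne_zero
  c_ne := cstD_ne_zero n
  c_self := cstD_self n
  c_orth h := cstD_of_orth h.1 h.2
  c_adj h := cstD_of_adj h.1 h.2
  c_adj' h := cstD_of_adj' h.1 h.2

section BorelB

variable (n : ℕ)

theorem genBE_rel {x y : FE n} (h : RelDE n x y) :
    RingQuot.mkAlgHom KK (RelDE n) x = RingQuot.mkAlgHom KK (RelDE n) y :=
  RingQuot.mkAlgHom_rel KK h

theorem mkAlgHom_XE (g : GenE (n + 2)) :
    RingQuot.mkAlgHom KK (RelDE n) (XE g) = genBE n g := rfl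

theorem genBE_conj (i j : Fin (n + 2)) :
    genBE n (.w j) * genBE n (.e i) * genBE n (.winv j) = cstD n i j • genBE n (.e i) := by
  by_cases hj : (j : ℕ) < n + 1
  · have := genBE_rel n (.d2we i j hj)
    rw [cstD, if_pos hj]
    simpa only [mkAlgHom_XE, map_mul, map_smul] using this
  · obtain rfl : j = Fin.last (n + 1) := Fin.ext (by simp only [Fin.val_last]; omega)
    rw [cstD, if_neg hj]
    split_ifs with hi
    · simpa only [mkAlgHom_XE, map_mul, map_smul] using genBE_rel n (.d2wne i hi)
    · simpa only [mkAlgHom_XE, map_mul, map_smul] using genBE_rel n (.d2wnen1 i (not_not.mp hi))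

theorem isRep_genBE : (datumD n).IsRep (fun i => genBE n (.e i)) (fun i => genBE n (.w i))
    (fun i => genBE n (.winv i)) where
  mul_inv i := by simpa only [mkAlgHom_XE, map_mul, map_one] using genBE_rel n (.winv_r i)
  inv_mul i := by simpa only [mkAlgHom_XE, map_mul, map_one] using genBE_rel n (.winv_l i)
  comm i j := by
    simpa only [mkAlgHom_XE, map_mul] using genBE_rel n (.comm (.w i) (.w j) trivial trivial)
  conj i j := by
    have h : genBE n (.winv j) * genBE n (.w j) = 1 := by
      simpa only [mkAlgHom_XE, map_mul, map_one] using genBE_rel n (.winv_l j)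
    rw [← smul_mul_assoc]
    refine Eq.trans ?_ (congrArg (· * genBE n (.w j)) (genBE_conj n i j))
    simp only [mul_assoc, h, mul_one]
  orth {i j} hij := by
    show qComm (cstD n j i) _ _ = 0
    obtain ⟨hlt, ha⟩ := hij
    by_cases hn : (i : ℕ) = n ∧ (j : ℕ) = n + 1
    · rw [cstD_spin hn.1 hn.2, qComm, sub_eq_zero]
      simpa only [mkAlgHom_XE, map_mul, map_smul] using genBE_rel n (.d5en i j hn.1 hn.2)
    · rw [cstD_of_orth_of_not hlt ha hn, qComm, one_smul]
      rw [Fin.lt_def] at hlt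
      simpa only [mkAlgHom_XE, map_mul, map_sub, map_zero] using
        genBE_rel n (.d5e i j (by rintro rfl; exact lt_irrefl _ hlt) ha hn (by omega))
  adj {i j} hij := by
    have := genBE_rel n (.d6a i j hij.1 hij.2)
    simpa only [mkAlgHom_XE, map_mul, map_sub, map_zero, map_add, map_smul, sq,
      ← mul_assoc, qSerre, datumD] using this
  adj' {i j} hij := by
    have := genBE_rel n (.d6b i j hij.1 hij.2)
    rw [mul_inv] at this
    simpa only [mkAlgHom_XE, map_mul, map_sub, map_zero, map_add, map_smul, sq,
      ← mul_assoc, qSerre, datumD] using this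

theorem isUniversal_genBE : (datumD n).IsUniversal (fun i => genBE n (.e i))
    (fun i => genBE n (.w i)) (fun i => genBE n (.winv i)) where
  rep := isRep_genBE n
  lift {A _ _ E' W' V'} h := by
    let g : GenE (n + 2) → A
      | .e i => E' i
      | .w i => W' i
      | .winv i => V' i
    have conj (i j : Fin (n + 2)) : W' j * E' i * V' j = cstD n i j • E' i := by
      rw [h.conj, smul_mul_assoc, mul_assoc, h.mul_inv, mul_one]
      rfl
    have key : ∀ ⦃x y : FE n⦄, RelDE n x y → FreeAlgebra.lift KK g x = FreeAlgebra.lift KK g y := by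
      intro x y hxy
      induction hxy with
      | comm a b ha hb =>
        simp only [map_mul, FreeAlgebra.lift_ι_apply]
        cases a <;> cases b <;> first | exact ha.elim | exact hb.elim | skip
        · exact h.commute _ _
        · exact h.commute_inv _ _
        · exact (h.commute_inv _ _).symm
        · exact h.inv_commute_inv _ _
      | winv_r i => simpa [g] using h.mul_inv i
      | winv_l i => simpa [g] using h.inv_mul i
      | d2we i j hj =>
        have := conj i j
        rw [cstD, if_pos hj] at this
        simpa only [map_mul, map_smul, FreeAlgebra.lift_ι_apply] using this
      | d2wne k hk =>
        have := conj k (Fin.last (n + 1))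
        rw [cstD, if_neg (by simp), if_pos hk] at this
        simpa only [map_mul, map_smul, FreeAlgebra.lift_ι_apply] using this
      | d2wnen1 k hk =>
        have := conj k (Fin.last (n + 1))
        rw [cstD, if_neg (by simp), if_neg (not_not.mpr hk)] at this
        simpa only [map_mul, map_smul, FreeAlgebra.lift_ι_apply] using this
      | d5e i j hne ha hp₁ hp₂ =>
        simp only [map_mul, map_sub, map_zero, FreeAlgebra.lift_ι_apply]
        rcases lt_or_gt_of_ne hne with hlt | hlt
        · have := h.orth (i := i) (j := j) ⟨hlt, ha⟩
          rwa [show (datumD n).c j i = 1 from cstD_of_orth_of_not hlt ha hp₁, qComm,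
            one_smul] at this
        · rw [apaD_comm] at ha
          have := h.orth (i := j) (j := i) ⟨hlt, ha⟩
          rw [show (datumD n).c i j = 1 from cstD_of_orth_of_not hlt ha (by tauto), qComm,
            one_smul] at this
          rw [← neg_sub, neg_eq_zero]
          exact this
      | d5en i j hi hj =>
        have := h.orth (i := i) (j := j) ⟨Fin.lt_def.mpr (by omega), apaD_spin hi hj⟩
        rw [show (datumD n).c j i = qr * qs from cstD_spin hi hj, qComm, sub_eq_zero] at this
        simpa only [map_mul, map_smul, FreeAlgebra.lift_ι_apply] using this
      | d6a i j hij ha =>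
        have := h.adj (i := i) (j := j) ⟨hij, ha⟩
        simpa only [map_mul, map_sub, map_zero, map_add, map_smul, sq, ← mul_assoc,
          FreeAlgebra.lift_ι_apply, qSerre, datumD, g] using this
      | d6b i j hij ha =>
        have := h.adj' (i := i) (j := j) ⟨hij, ha⟩
        rw [mul_inv]
        simpa only [map_mul, map_sub, map_zero, map_add, map_smul, sq, ← mul_assoc,
          FreeAlgebra.lift_ι_apply, qSerre, datumD, g] using this
    exact ⟨RingQuot.liftAlgHom KK ⟨FreeAlgebra.lift KK g, key⟩, fun i => by simp [genBE, g]⟩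
  induction {P} hk hE hW hV hadd hmul x := by
    obtain ⟨y, rfl⟩ := RingQuot.mkAlgHom_surjective KK (RelDE n) x
    induction y using FreeAlgebra.induction with
    | grade0 k => simpa only [AlgHom.commutes] using hk k
    | grade1 a => cases a with
      | e i => exact hE i
      | w i => exact hW i
      | winv i => exact hV i
    | mul a b ha hb => rw [map_mul]; exact hmul _ _ ha hb
    | add a b ha hb => rw [map_add]; exact hadd _ _ ha hb

end BorelB

section BorelB'

variable (n : ℕ)

theorem genBF_rel {x y : FF n} (h : RelDF n x y) :
    RingQuot.mkAlgHom KK (RelDF n) x = RingQuot.mkAlgHom KK (RelDF n) y :=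
  RingQuot.mkAlgHom_rel KK h

theorem mkAlgHom_XF (g : GenF (n + 2)) :
    RingQuot.mkAlgHom KK (RelDF n) (XF g) = genBF n g := rfl

section

variable {n} (i j : Fin (n + 2))

theorem cstD_swap_of_lt (hj : (j : ℕ) < n + 1) :
    cstD n j i = qs ^ (-ipaD n j i) * qr ^ (-ipaD n ((j : ℕ) + 1) i) := by
  have hi := i.isLt
  have h₁ : cstExpR n j i = -ipaD n ((j : ℕ) + 1) i := by
    unfold cstExpR ipaD; split_ifs <;> omega
  have h₂ : cstExpS n j i = -ipaD n j i := by
    unfold cstExpS ipaD; split_ifs <;> omega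
  rw [cstD_eq, h₁, h₂, mul_comm]

theorem cstD_last_of_ne (hi : (i : ℕ) ≠ n) :
    cstD n (Fin.last (n + 1)) i = qs ^ (-ipaD n n i) * qr ^ ipaD n (n + 1) i := by
  have hlt := i.isLt
  have h₁ : cstExpR n (n + 1) i = ipaD n (n + 1) i := by
    unfold cstExpR ipaD; split_ifs <;> omega
  have h₂ : cstExpS n (n + 1) i = -ipaD n n i := by
    unfold cstExpS ipaD; split_ifs <;> omega
  rw [cstD_eq, Fin.val_last, h₁, h₂, mul_comm]

theorem cstD_last_of_eq (hi : (i : ℕ) = n) :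
    cstD n (Fin.last (n + 1)) i = qs ^ (-ipaD n (n + 1) i) * qr ^ ipaD n n i := by
  have h₁ : cstExpR n (n + 1) i = ipaD n n i := by
    unfold cstExpR ipaD; split_ifs <;> omega
  have h₂ : cstExpS n (n + 1) i = -ipaD n (n + 1) i := by
    unfold cstExpS ipaD; split_ifs <;> omega
  rw [cstD_eq, Fin.val_last, h₁, h₂, mul_comm]

end

theorem genBF_conj (i j : Fin (n + 2)) :
    genBF n (.wp j) * genBF n (.f i) * genBF n (.wpinv j) = cstD n j i • genBF n (.f i) := by
  by_cases hj : (j : ℕ) < n + 1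
  · rw [cstD_swap_of_lt i j hj]
    simpa only [mkAlgHom_XF, map_mul, map_smul] using genBF_rel n (.d3wpf i j hj)
  · obtain rfl : j = Fin.last (n + 1) := Fin.ext (by simp only [Fin.val_last]; omega)
    by_cases hi : (i : ℕ) = n
    · rw [cstD_last_of_eq i hi]
      simpa only [mkAlgHom_XF, map_mul, map_smul] using genBF_rel n (.d3wpnfn1 i hi)
    · rw [cstD_last_of_ne i hi]
      simpa only [mkAlgHom_XF, map_mul, map_smul] using genBF_rel n (.d3wpnf i hi)

section

variable {A : Type*} [Ring A] [Algebra KK A] (x y : A)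

theorem qComm_spin : qComm (qr * qs)⁻¹ x y = -(qr * qs)⁻¹ • (y * x - (qr * qs) • (x * y)) := by
  have h : -(qr * qs)⁻¹ * (qr * qs) = -1 := by
    rw [neg_mul, inv_mul_cancel₀ (mul_ne_zero qr_ne_zero qs_ne_zero)]
  rw [qComm, smul_sub, smul_smul, h, neg_smul, neg_smul, one_smul]
  abel

theorem qSerre_inv : qSerre qs⁻¹ qr⁻¹ x y = (qr * qs)⁻¹ •
    (y * x ^ 2 - (qr + qs) • (x * y * x) + (qr * qs) • (x ^ 2 * y)) := by
  have hr := qr_ne_zero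
  have hs := qs_ne_zero
  have h₁ : (qr * qs)⁻¹ * (qr + qs) = qs⁻¹ + qr⁻¹ := by field_simp
  simp only [qSerre, sq, ← mul_assoc y, smul_add, smul_sub, smul_smul, h₁,
    inv_mul_cancel₀ (mul_ne_zero hr hs), one_smul, ← mul_inv_rev]
  abel

theorem qSerre_inv_inv : qSerre qs⁻¹⁻¹ qr⁻¹⁻¹ y x = (qr * qs) •
    (x * y ^ 2 - (qr⁻¹ + qs⁻¹) • (y * x * y) + (qr * qs)⁻¹ • (y ^ 2 * x)) := by
  have hr := qr_ne_zero
  have hs := qs_ne_zero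
  have h₁ : (qr * qs) * (qr⁻¹ + qs⁻¹) = qs + qr := by field_simp
  simp only [qSerre, sq, ← mul_assoc x, smul_add, smul_sub, smul_smul, h₁,
    mul_inv_cancel₀ (mul_ne_zero hr hs), one_smul, inv_inv, mul_comm qs qr]
  abel

end

theorem isRep_genBF : (datumD n).dual.IsRep (fun i => genBF n (.f i)) (fun i => genBF n (.wp i))
    (fun i => genBF n (.wpinv i)) where
  mul_inv i := by simpa only [mkAlgHom_XF, map_mul, map_one] using genBF_rel n (.wpinv_r i)
  inv_mul i := by simpa only [mkAlgHom_XF, map_mul, map_one] using genBF_rel n (.wpinv_l i)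
  comm i j := by
    simpa only [mkAlgHom_XF, map_mul] using genBF_rel n (.comm (.wp i) (.wp j) trivial trivial)
  conj i j := by
    have h : genBF n (.wpinv j) * genBF n (.wp j) = 1 := by
      simpa only [mkAlgHom_XF, map_mul, map_one] using genBF_rel n (.wpinv_l j)
    rw [← smul_mul_assoc]
    refine Eq.trans ?_ (congrArg (· * genBF n (.wp j)) (genBF_conj n i j))
    simp only [mul_assoc, h, mul_one]
  orth {i j} hij := by
    show qComm (cstD n i j) _ _ = 0
    obtain ⟨hlt, ha⟩ := hij
    rw [cstD_of_orth hlt ha]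
    by_cases hn : (i : ℕ) = n ∧ (j : ℕ) = n + 1
    · rw [cstD_spin hn.1 hn.2, qComm_spin, smul_eq_zero_of_right _ (sub_eq_zero.mpr ?_)]
      simpa only [mkAlgHom_XF, map_mul, map_smul] using genBF_rel n (.d5fn i j hn.1 hn.2)
    · rw [cstD_of_orth_of_not hlt ha hn, inv_one, qComm, one_smul]
      rw [Fin.lt_def] at hlt
      simpa only [mkAlgHom_XF, map_mul, map_sub, map_zero] using
        genBF_rel n (.d5f i j (by rintro rfl; exact lt_irrefl _ hlt) ha hn (by omega))
  adj {i j} hij := by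
    refine (qSerre_inv _ _).trans (smul_eq_zero_of_right _ ?_)
    simpa only [mkAlgHom_XF, map_mul, map_sub, map_zero, map_add, map_smul, map_pow] using
      genBF_rel n (.d7a i j hij.1 hij.2)
  adj' {i j} hij := by
    refine (qSerre_inv_inv _ _).trans (smul_eq_zero_of_right _ ?_)
    simpa only [mkAlgHom_XF, map_mul, map_sub, map_zero, map_add, map_smul, map_pow] using
      genBF_rel n (.d7b i j hij.1 hij.2)

theorem isUniversal_genBF : (datumD n).dual.IsUniversal (fun i => genBF n (.f i))
    (fun i => genBF n (.wp i)) (fun i => genBF n (.wpinv i)) where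
  rep := isRep_genBF n
  lift {A _ _ E' W' V'} h := by
    let g : GenF (n + 2) → A
      | .f i => E' i
      | .wp i => W' i
      | .wpinv i => V' i
    have hne := mul_ne_zero qr_ne_zero qs_ne_zero
    have conj (i j : Fin (n + 2)) : W' j * E' i * V' j = cstD n j i • E' i := by
      rw [h.conj, smul_mul_assoc, mul_assoc, h.mul_inv, mul_one]
      rfl
    have key : ∀ ⦃x y : FF n⦄, RelDF n x y → FreeAlgebra.lift KK g x = FreeAlgebra.lift KK g y := by
      intro x y hxy
      induction hxy with
      | comm a b ha hb =>
        simp only [map_mul, FreeAlgebra.lift_ι_apply]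
        cases a <;> cases b <;> first | exact ha.elim | exact hb.elim | skip
        · exact h.commute _ _
        · exact h.commute_inv _ _
        · exact (h.commute_inv _ _).symm
        · exact h.inv_commute_inv _ _
      | wpinv_r i => simpa [g] using h.mul_inv i
      | wpinv_l i => simpa [g] using h.inv_mul i
      | d3wpf i j hj =>
        rw [← cstD_swap_of_lt i j hj]
        simpa only [map_mul, map_smul, FreeAlgebra.lift_ι_apply] using conj i j
      | d3wpnf k hk =>
        rw [← cstD_last_of_ne k hk]
        simpa only [map_mul, map_smul, FreeAlgebra.lift_ι_apply] using conj k (Fin.last (n + 1))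
      | d3wpnfn1 k hk =>
        rw [← cstD_last_of_eq k hk]
        simpa only [map_mul, map_smul, FreeAlgebra.lift_ι_apply] using conj k (Fin.last (n + 1))
      | d5f i j hne ha hp₁ hp₂ =>
        simp only [map_mul, map_sub, map_zero, FreeAlgebra.lift_ι_apply]
        rcases lt_or_gt_of_ne hne with hlt | hlt
        · have := h.orth (i := i) (j := j) ⟨hlt, ha⟩
          rwa [show (datumD n).dual.c j i = cstD n i j from rfl, cstD_of_orth hlt ha,
            cstD_of_orth_of_not hlt ha hp₁, inv_one, qComm, one_smul] at this
        · rw [apaD_comm] at ha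
          have := h.orth (i := j) (j := i) ⟨hlt, ha⟩
          rw [show (datumD n).dual.c i j = cstD n j i from rfl, cstD_of_orth hlt ha,
            cstD_of_orth_of_not hlt ha (by tauto), inv_one, qComm, one_smul] at this
          rw [← neg_sub, neg_eq_zero]
          exact this
      | d5fn i j hi hj =>
        have hlt : i < j := Fin.lt_def.mpr (by omega)
        have := h.orth (i := i) (j := j) ⟨hlt, apaD_spin hi hj⟩
        rw [show (datumD n).dual.c j i = cstD n i j from rfl, cstD_of_orth hlt (apaD_spin hi hj),
          cstD_spin hi hj, qComm_spin, smul_eq_zero_iff_right (neg_ne_zero.mpr (inv_ne_zero hne)),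
          sub_eq_zero] at this
        simpa only [map_mul, map_smul, FreeAlgebra.lift_ι_apply] using this
      | d7a i j hij ha =>
        have := (qSerre_inv _ _).symm.trans (h.adj (i := i) (j := j) ⟨hij, ha⟩)
        rw [smul_eq_zero_iff_right (inv_ne_zero hne)] at this
        simpa only [map_mul, map_sub, map_zero, map_add, map_smul, map_pow,
          FreeAlgebra.lift_ι_apply] using this
      | d7b i j hij ha =>
        have := (qSerre_inv_inv _ _).symm.trans (h.adj' (i := i) (j := j) ⟨hij, ha⟩)
        rw [smul_eq_zero_iff_right hne] at this
        simpa only [map_mul, map_sub, map_zero, map_add, map_smul, map_pow,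
          FreeAlgebra.lift_ι_apply] using this
    exact ⟨RingQuot.liftAlgHom KK ⟨FreeAlgebra.lift KK g, key⟩, fun i => by simp [genBF, g]⟩
  induction {P} hk hE hW hV hadd hmul x := by
    obtain ⟨y, rfl⟩ := RingQuot.mkAlgHom_surjective KK (RelDF n) x
    induction y using FreeAlgebra.induction with
    | grade0 k => simpa only [AlgHom.commutes] using hk k
    | grade1 a => cases a with
      | f i => exact hE i
      | wp i => exact hW i
      | wpinv i => exact hV i
    | mul a b ha hb => rw [map_mul]; exact hmul _ _ ha hb
    | add a b ha hb => rw [map_add]; exact hadd _ _ ha hb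

theorem pairCond_iff {ΔB : BA n →ₐ[KK] (BA n ⊗[KK] BA n)} {εB : BA n →ₐ[KK] KK}
    {ΔB' : BA' n →ₐ[KK] (BA' n ⊗[KK] BA' n)} {εB' : BA' n →ₐ[KK] KK}
    {p : BA' n →ₗ[KK] BA n →ₗ[KK] KK} : PairCond n ΔB εB ΔB' εB' p ↔
      (datumD n).IsSkewPairing (fun i => genBE n (.e i)) (fun i => genBE n (.w i))
        (fun i => genBE n (.winv i)) (fun i => genBF n (.f i)) (fun i => genBF n (.wp i))
        (fun i => genBF n (.wpinv i)) ΔB εB ΔB' εB' (qs - qr)⁻¹ p :=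
  ⟨fun ⟨h₁, h₂, h₃, h₄, h₅, h₆, h₇, h₈, h₉, h₁₀, h₁₁, h₁₂, h₁₃⟩ =>
    ⟨h₁, h₂, h₃, h₄, h₅, h₆, h₇, h₈, h₉, h₁₀, h₁₁, h₁₂, h₁₃⟩,
    fun ⟨h₁, h₂, h₃, h₄, h₅, h₆, h₇, h₈, h₉, h₁₀, h₁₁, h₁₂, h₁₃⟩ =>
    ⟨h₁, h₂, h₃, h₄, h₅, h₆, h₇, h₈, h₉, h₁₀, h₁₁, h₁₂, h₁₃⟩⟩

end BorelB'

theorem stmt6 (n : ℕ) :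
    ∃ (ΔB : BA n →ₐ[KK] (BA n ⊗[KK] BA n)) (εB : BA n →ₐ[KK] KK) (SB : BA n →ₗ[KK] BA n)
      (ΔB' : BA' n →ₐ[KK] (BA' n ⊗[KK] BA' n)) (εB' : BA' n →ₐ[KK] KK)
      (SB' : BA' n →ₗ[KK] BA' n),
      (∀ i : Fin (n+2),
        ΔB (genBE n (.w i)) = genBE n (.w i) ⊗ₜ[KK] genBE n (.w i) ∧
        ΔB (genBE n (.winv i)) = genBE n (.winv i) ⊗ₜ[KK] genBE n (.winv i) ∧
        ΔB (genBE n (.e i))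
          = genBE n (.e i) ⊗ₜ[KK] 1 + genBE n (.w i) ⊗ₜ[KK] genBE n (.e i)) ∧
      (∀ i : Fin (n+2), εB (genBE n (.w i)) = 1 ∧ εB (genBE n (.winv i)) = 1 ∧
        εB (genBE n (.e i)) = 0) ∧
      SB 1 = 1 ∧ (∀ x y, SB (x * y) = SB y * SB x) ∧
      (∀ i : Fin (n+2), SB (genBE n (.w i)) = genBE n (.winv i) ∧
        SB (genBE n (.winv i)) = genBE n (.w i) ∧
        SB (genBE n (.e i)) = -(genBE n (.winv i) * genBE n (.e i))) ∧
      (∀ i : Fin (n+2),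
        ΔB' (genBF n (.wp i)) = genBF n (.wp i) ⊗ₜ[KK] genBF n (.wp i) ∧
        ΔB' (genBF n (.wpinv i)) = genBF n (.wpinv i) ⊗ₜ[KK] genBF n (.wpinv i) ∧
        ΔB' (genBF n (.f i))
          = 1 ⊗ₜ[KK] genBF n (.f i) + genBF n (.f i) ⊗ₜ[KK] genBF n (.wp i)) ∧
      (∀ i : Fin (n+2), εB' (genBF n (.wp i)) = 1 ∧ εB' (genBF n (.wpinv i)) = 1 ∧
        εB' (genBF n (.f i)) = 0) ∧
      SB' 1 = 1 ∧ (∀ x y, SB' (x * y) = SB' y * SB' x) ∧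
      (∀ i : Fin (n+2), SB' (genBF n (.wp i)) = genBF n (.wpinv i) ∧
        SB' (genBF n (.wpinv i)) = genBF n (.wp i) ∧
        SB' (genBF n (.f i)) = -(genBF n (.f i) * genBF n (.wpinv i))) ∧
      (∃! p : BA' n →ₗ[KK] BA n →ₗ[KK] KK, PairCond n ΔB εB ΔB' εB' p) ∧
      (∀ p : BA' n →ₗ[KK] BA n →ₗ[KK] KK, PairCond n ΔB εB ΔB' εB' p →
        ∀ a b, p (SB' a) (SB b) = p a b) := by
  have hE := isUniversal_genBE n
  have hF := isUniversal_genBF n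
  obtain ⟨ΔB, hΔ⟩ := hE.exists_comul
  obtain ⟨εB, hε⟩ := hE.exists_counit
  obtain ⟨SB, hS₁, hSmul, hS⟩ := hE.exists_antipode
  obtain ⟨ΔB', hΔ'⟩ := hF.exists_comul_swap
  obtain ⟨εB', hε'⟩ := hF.exists_counit
  obtain ⟨SB', hS₁', hSmul', hS'⟩ := hF.exists_antipode_swap
  have hB : SkewDatum.IsBialgebra _ _ _ ΔB εB := ⟨hΔ, hε⟩
  have hB' : SkewDatum.IsBialgebraSwap _ _ _ ΔB' εB' := ⟨hΔ', hε'⟩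
  refine ⟨ΔB, εB, SB, ΔB', εB', SB', hΔ, hε, hS₁, hSmul, hS, hΔ', hε', hS₁', hSmul', hS', ?_,
    fun p hp a b => ?_⟩
  · obtain ⟨p, hp⟩ := SkewDatum.exists_isSkewPairing hE hF hB hB' (qs - qr)⁻¹
    exact ⟨p, (pairCond_iff n).mpr hp, fun q hq => ((pairCond_iff n).mp hq).unique hp hE hF hB⟩
  · exact ((pairCond_iff n).mp hp).antipode_apply hE hF hB hB' ⟨hS₁, hSmul, hS⟩
      ⟨hS₁', hSmul', hS'⟩ a b
end
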